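/- (G.Horváth–Lángi) Let K be a convex body in EuclideanSpace ℝ (Fin d), d ≥ 2. Then sup { vol(convexHull ℝ (K ∪ σ_H(K))) : H an affine hyperplane of EuclideanSpace ℝ (Fin d) with K ∩ σ_H(K) ≠ ∅ } ≥ (1 + 2·v_{d−1}/v_d) · vol(K), where σ_H denotes the orthogonal reflection in the hyperplane H, and equality holds if and only if K is a closed Euclidean ball (of some center and positive radius). -/

import Mathlib

open MeasureTheory

/-- The volume of the closed unit ball of Euclidean `n`-space. -/
noncomputable def unitBallVol (n : ℕ) : ℝ :=
  (volume (Metric.closedBall (0 : EuclideanSpace ℝ (Fin n)) 1)).toReal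

/-- The set of volumes of convex hulls `conv(K ∪ σ_H(K))` over all affine hyperplanes `H`
whose reflection `σ_H` maps `K` to a set meeting `K`. -/
noncomputable def hyperplaneReflVols {d : ℕ} (K : Set (EuclideanSpace ℝ (Fin d))) : Set ℝ :=
  {v : ℝ | ∃ (H : AffineSubspace ℝ (EuclideanSpace ℝ (Fin d))) (_ : Nonempty H),
    Module.finrank ℝ H.direction = d - 1 ∧
    (K ∩ (EuclideanGeometry.reflection H) '' K).Nonempty ∧
    v = (volume (convexHull ℝ (K ∪ (EuclideanGeometry.reflection H) '' K))).toReal}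

section Auxiliary
open Set
open scoped Pointwise ENNReal RealInnerProductSpace

section Fub
variable {E : Type*} [NormedAddCommGroup E] [InnerProductSpace ℝ E] [FiniteDimensional ℝ E]
  [MeasurableSpace E] [BorelSpace E]

/-- Orthogonal decomposition is volume preserving. -/
theorem mp_decomp (s : Submodule ℝ E) :
    MeasurePreserving (fun q : s × sᗮ => (q.1 : E) + q.2) volume volume := by
  have h := (s.measurePreserving_measurableEquivProd (0 : E)).symm
  have h' : (fun q : s × sᗮ => (q.1 : E) + q.2) = (s.measurableEquivProd (0 : E)).symm := by
    ext q
    rw [s.measurableEquivProd_symm_apply]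
    simp
  rw [h', ← InnerProductSpace.euclideanHausdorffMeasure_eq_volume]
  exact h

/-- Fubini along a unit direction. -/
theorem lintegral_fiber {e : E} (he : ‖e‖ = 1) {f : E → ℝ≥0∞} (hf : Measurable f) :
    ∫⁻ x, f x = ∫⁻ y : (Submodule.span ℝ {e})ᗮ, ∫⁻ s : ℝ, f ((y : E) + s • e) := by
  have h1 := (LinearIsometryEquiv.toSpanUnitSingleton e he).measurePreserving
  have h5 : MeasurePreserving (fun q : Submodule.span ℝ {e} × (Submodule.span ℝ {e})ᗮ =>
      (q.1 : E) + q.2) (volume.prod volume) volume := mp_decomp _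
  have h5m : Measurable (fun q : Submodule.span ℝ {e} × (Submodule.span ℝ {e})ᗮ =>
      (q.1 : E) + q.2) := h5.measurable
  have h6 : MeasurePreserving (LinearIsometryEquiv.toSpanUnitSingleton e he).toHomeomorph.toMeasurableEquiv
    volume volume := h1
  rw [← h5.lintegral_comp hf, lintegral_prod_symm (fun q : Submodule.span ℝ {e} × (Submodule.span ℝ {e})ᗮ =>
      f ((q.1 : E) + q.2)) (hf.comp h5m).aemeasurable]
  refine lintegral_congr fun y => ?_
  rw [← h6.lintegral_comp_emb (MeasurableEquiv.measurableEmbedding _)]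
  refine lintegral_congr fun s => ?_
  congr 1
  rw [add_comm]
  rfl

theorem volume_fiber {e : E} (he : ‖e‖ = 1) {S : Set E} (hS : MeasurableSet S) :
    volume S = ∫⁻ y : (Submodule.span ℝ {e})ᗮ, volume {s : ℝ | (y : E) + s • e ∈ S} := by
  rw [← lintegral_indicator_one hS, lintegral_fiber he (measurable_one.indicator hS)]
  refine lintegral_congr fun y => ?_
  rw [← lintegral_indicator_one]
  · rfl
  · exact (by fun_prop : Measurable fun s : ℝ => (y : E) + s • e) hS

end Fub

section Stein
variable {E : Type*} [NormedAddCommGroup E] [InnerProductSpace ℝ E]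

/-- Removing the `e` component. -/
noncomputable def perpL (e : E) : E →L[ℝ] E :=
  ContinuousLinearMap.id ℝ E - (innerSL ℝ e).smulRight e

/-- Reflection in `eᗮ` (for unit `e`). -/
noncomputable def rfL (e : E) : E →L[ℝ] E :=
  ContinuousLinearMap.id ℝ E - (2 : ℝ) • (innerSL ℝ e).smulRight e

theorem perpL_apply (e x : E) : perpL e x = x - ⟪e, x⟫ • e := by simp [perpL]
theorem rfL_apply (e x : E) : rfL e x = x - (2 * ⟪e, x⟫) • e := by simp [rfL, mul_smul]

/-- Fiberwise average of `A` and the reflection of `B`. -/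
def fsum (e : E) (A B : Set E) : Set E :=
  (fun q : E × E => (1/2 : ℝ) • (q.1 + rfL e q.2)) '' {q | q ∈ A ×ˢ B ∧ perpL e q.1 = perpL e q.2}

theorem mem_fsum {e : E} {A B : Set E} {x : E} : x ∈ fsum e A B ↔
    ∃ a ∈ A, ∃ b ∈ B, perpL e a = perpL e b ∧ (1/2 : ℝ) • (a + rfL e b) = x := by
  constructor
  · rintro ⟨⟨a, b⟩, ⟨⟨ha, hb⟩, h⟩, rfl⟩
    exact ⟨a, ha, b, hb, h, rfl⟩
  · rintro ⟨a, ha, b, hb, h, rfl⟩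
    exact ⟨⟨a, b⟩, ⟨⟨ha, hb⟩, h⟩, rfl⟩

theorem fsum_compact (e : E) {A B : Set E} (hA : IsCompact A) (hB : IsCompact B) :
    IsCompact (fsum e A B) := by
  refine IsCompact.image ?_ (by fun_prop)
  refine (hA.prod hB).inter_right (t := {q : E × E | perpL e q.1 = perpL e q.2}) ?_
  exact isClosed_eq (by fun_prop) (by fun_prop)

theorem fsum_convex (e : E) {A B : Set E} (hA : Convex ℝ A) (hB : Convex ℝ B) :
    Convex ℝ (fsum e A B) := by
  intro x hx y hy s t hs ht hst
  rw [mem_fsum] at *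
  obtain ⟨a, ha, b, hb, h, rfl⟩ := hx
  obtain ⟨a', ha', b', hb', h', rfl⟩ := hy
  refine ⟨s • a + t • a', hA ha ha' hs ht hst, s • b + t • b', hB hb hb' hs ht hst, ?_, ?_⟩
  · simp [h, h']
  · simp only [map_add, map_smul]; module

theorem fsum_mono (e : E) {A B A' B' : Set E} (hA : A ⊆ A') (hB : B ⊆ B') :
    fsum e A B ⊆ fsum e A' B' := by
  intro x hx
  rw [mem_fsum] at *
  obtain ⟨a, ha, b, hb, h⟩ := hx
  exact ⟨a, hA ha, b, hB hb, h⟩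

theorem inner_self_one {e : E} (he : ‖e‖ = 1) : ⟪e, e⟫ = (1:ℝ) := by
  rw [real_inner_self_eq_norm_sq, he]; norm_num

theorem rfL_rfL {e : E} (he : ‖e‖ = 1) (x : E) : rfL e (rfL e x) = x := by
  have := inner_self_one he
  simp only [rfL_apply, inner_sub_right, inner_smul_right, this]
  module

theorem rfL_norm {e : E} (he : ‖e‖ = 1) (x : E) : ‖rfL e x‖ = ‖x‖ := by
  have := inner_self_one he
  rw [← sq_eq_sq₀ (norm_nonneg _) (norm_nonneg _), ← real_inner_self_eq_norm_sq,
    ← real_inner_self_eq_norm_sq, rfL_apply]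
  simp only [inner_sub_right, inner_smul_right, inner_sub_left, inner_smul_left, this,
    real_inner_comm e x]
  simp
  ring

theorem fsum_ball {e : E} (he : ‖e‖ = 1) {A : Set E} {R : ℝ}
    (hA : A ⊆ Metric.closedBall 0 R) : fsum e A A ⊆ Metric.closedBall 0 R := by
  intro x hx
  rw [mem_fsum] at hx
  obtain ⟨a, ha, b, hb, h, rfl⟩ := hx
  have ha := hA ha
  have hb := hA hb
  rw [mem_closedBall_zero_iff] at *
  have := norm_add_le a (rfL e b)
  rw [rfL_norm he] at this
  rw [norm_smul]
  norm_num
  linarith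

theorem fsum_nonempty (e : E) {A : Set E} (hA : A.Nonempty) : (fsum e A A).Nonempty := by
  obtain ⟨a, ha⟩ := hA
  exact ⟨_, mem_fsum.2 ⟨a, ha, a, ha, rfl, rfl⟩⟩

theorem fsum_sub (e : E) (A B : Set E) (h : A - A ⊆ B) : fsum e A A - fsum e A A ⊆ fsum e B B := by
  rintro _ ⟨x, hx, y, hy, rfl⟩
  rw [mem_fsum] at *
  obtain ⟨a, ha, b, hb, h1, rfl⟩ := hx
  obtain ⟨a', ha', b', hb', h2, rfl⟩ := hy
  refine ⟨a - a', h (sub_mem_sub ha ha'), b - b', h (sub_mem_sub hb hb'), by simp [h1, h2], ?_⟩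
  simp only [map_sub]; module

/-- The sweep of `K` along `x`. -/
def sweep (K : Set E) (x : E) : Set E := (fun q : E × ℝ => q.1 + q.2 • x) '' (K ×ˢ Icc (0:ℝ) 1)

theorem mem_sweep {K : Set E} {x z : E} :
    z ∈ sweep K x ↔ ∃ k ∈ K, ∃ t ∈ Icc (0:ℝ) 1, k + t • x = z := by
  constructor
  · rintro ⟨⟨a, b⟩, ⟨ha, hb⟩, rfl⟩
    exact ⟨a, ha, b, hb, rfl⟩
  · rintro ⟨a, ha, b, hb, rfl⟩
    exact ⟨⟨a, b⟩, ⟨ha, hb⟩, rfl⟩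

theorem sweep_compact {K : Set E} (hK : IsCompact K) (x : E) : IsCompact (sweep K x) :=
  (hK.prod isCompact_Icc).image (by fun_prop)

theorem sweep_eq_add (K : Set E) (x : E) : sweep K x = K + (fun t : ℝ => t • x) '' Icc 0 1 := by
  ext z
  rw [mem_sweep, mem_add]
  constructor
  · rintro ⟨k, hk, t, ht, rfl⟩
    exact ⟨k, hk, t • x, ⟨t, ht, rfl⟩, rfl⟩
  · rintro ⟨k, hk, _, ⟨t, ht, rfl⟩, rfl⟩
    exact ⟨k, hk, t, ht, rfl⟩

theorem sweep_convex {K : Set E} (hK : Convex ℝ K) (x : E) : Convex ℝ (sweep K x) := by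
  rw [sweep_eq_add]
  refine hK.add ?_
  exact (convex_Icc (0:ℝ) 1).is_linear_image (f := fun t : ℝ => t • x)
    (LinearMap.toSpanSingleton ℝ E x).isLinear

theorem sweep_mono {K K' : Set E} (h : K ⊆ K') (x : E) : sweep K x ⊆ sweep K' x := by
  intro z hz
  rw [mem_sweep] at *
  obtain ⟨k, hk, t⟩ := hz
  exact ⟨k, h hk, t⟩

theorem sweep_fsum (e : E) (K : Set E) {x₀ x₁ : E} (h : perpL e x₀ = perpL e x₁) :
    sweep (fsum e K K) ((1/2 : ℝ) • (x₀ + rfL e x₁)) ⊆ fsum e (sweep K x₀) (sweep K x₁) := by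
  intro z hz
  obtain ⟨k, hk, t, ht, rfl⟩ := mem_sweep.1 hz
  obtain ⟨a, ha, b, hb, h1, rfl⟩ := mem_fsum.1 hk
  refine mem_fsum.2 ⟨a + t • x₀, mem_sweep.2 ⟨a, ha, t, ht, rfl⟩, b + t • x₁,
    mem_sweep.2 ⟨b, hb, t, ht, rfl⟩, by simp [h, h1], ?_⟩
  simp only [map_add, map_smul]; module

/-- The fiber of a set over `y` in direction `e`. -/
def fib (e : E) (A : Set E) (y : E) : Set ℝ := {s : ℝ | y + s • e ∈ A}

theorem fib_eq_preimage (e : E) (A : Set E) (y : E) : fib e A y = (fun s : ℝ => y + s • e) ⁻¹' A := rfl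

theorem fib_convex (e : E) {A : Set E} (hA : Convex ℝ A) (y : E) : Convex ℝ (fib e A y) := by
  intro s hs t ht a b ha hb hab
  have := hA hs ht ha hb hab
  show y + (a • s + b • t) • e ∈ A
  convert this using 1
  have h : y = (a + b) • y := by rw [hab, one_smul]
  nth_rewrite 1 [h]
  simp only [smul_eq_mul]
  module

theorem fib_compact {e : E} (he : ‖e‖ = 1) {A : Set E} (hA : IsCompact A) (y : E) :
    IsCompact (fib e A y) := by
  refine Metric.isCompact_of_isClosed_isBounded ?_ ?_
  · exact hA.isClosed.preimage (by fun_prop)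
  · obtain ⟨R, hR⟩ := hA.isBounded.subset_closedBall 0
    refine (Metric.isBounded_closedBall (x := (0:ℝ)) (r := R + ‖y‖)).subset ?_
    intro s hs
    have h1 := hR hs
    rw [mem_closedBall_zero_iff] at *
    have : s • e = (y + s • e) - y := by abel
    have h2 : ‖s • e‖ = ‖s‖ := by rw [norm_smul, he, mul_one]
    rw [← h2, this]
    exact (norm_sub_le _ _).trans (by linarith)

theorem fib_cases {e : E} (he : ‖e‖ = 1) {A : Set E} (hA : IsCompact A) (hA' : Convex ℝ A) (y : E) :
    fib e A y = ∅ ∨ ∃ p q : ℝ, p ≤ q ∧ fib e A y = Icc p q := by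
  rcases (fib e A y).eq_empty_or_nonempty with h | h
  · exact Or.inl h
  · right
    have hc := fib_compact he hA y
    have := eq_Icc_of_connected_compact ⟨h, (fib_convex e hA' y).isPreconnected⟩ hc
    refine ⟨_, _, ?_, this⟩
    rw [this] at h
    exact nonempty_Icc.1 h

theorem fib_fsum {e : E} (he : ‖e‖ = 1) (A B : Set E) {y : E} (hy : ⟪e, y⟫ = (0:ℝ)) :
    fib e (fsum e A B) y = {s | ∃ p ∈ fib e A y, ∃ q ∈ fib e B y, s = (p - q) / 2} := by
  have hee := inner_self_one he
  ext s
  simp only [fib, mem_ofPred_eq, mem_fsum]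
  constructor
  · rintro ⟨a, ha, b, hb, h, h2⟩
    simp only [perpL_apply, rfL_apply] at h h2
    have h3 : ⟪e, (1/2 : ℝ) • (a + (b - (2 * ⟪e, b⟫) • e))⟫ = ⟪e, y + s • e⟫ := by rw [h2]
    simp only [inner_smul_right, inner_add_right, inner_sub_right, hee, hy] at h3
    have hsub : y = a - ⟪e, a⟫ • e := by
      have h4 : a = b + ⟪e, a⟫ • e - ⟪e, b⟫ • e := by
        rw [← sub_eq_zero] at h ⊢
        rw [← h]; module
      have h5 : y = (1/2 : ℝ) • (a + (b - (2 * ⟪e, b⟫) • e)) - s • e := by rw [h2]; abel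
      have hs : s = (⟪e, a⟫ - ⟪e, b⟫) / 2 := by linarith
      have h6 : b = a - ⟪e, a⟫ • e + ⟪e, b⟫ • e := by rw [h]; abel
      rw [h5, hs]
      generalize ⟪e, a⟫ = α at *
      generalize ⟪e, b⟫ = β at *
      rw [h6]
      module
    refine ⟨⟪e, a⟫, ?_, ⟪e, b⟫, ?_, by linarith⟩
    · rw [hsub]; simpa using ha
    · rw [hsub, h]; simpa using hb
  · rintro ⟨p, hp, q, hq, rfl⟩
    refine ⟨_, hp, _, hq, ?_, ?_⟩
    · simp only [perpL_apply, inner_add_right, inner_smul_right, hee, hy]; module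
    · simp only [rfL_apply, inner_add_right, inner_smul_right, hee, hy]; module

theorem avg_Icc {a b c d : ℝ} (h : a ≤ b) (h' : c ≤ d) :
    {s | ∃ p ∈ Icc a b, ∃ q ∈ Icc c d, s = (p - q) / 2} = Icc ((a - d) / 2) ((b - c) / 2) := by
  ext s
  constructor
  · rintro ⟨p, ⟨h1, h2⟩, q, ⟨h3, h4⟩, rfl⟩
    constructor <;> linarith
  · rintro ⟨h1, h2⟩
    by_cases h3 : s ≤ (b - d) / 2
    · exact ⟨2 * s + d, ⟨by linarith, by linarith⟩, d, ⟨h', le_rfl⟩, by ring⟩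
    · push Not at h3
      exact ⟨b, ⟨h, le_rfl⟩, b - 2 * s, ⟨by linarith, by linarith⟩, by ring⟩

theorem fib_fsum_self {e : E} (he : ‖e‖ = 1) {A : Set E} {y : E} (hy : ⟪e, y⟫ = (0:ℝ)) {p q : ℝ}
    (hpq : p ≤ q) (h : fib e A y = Icc p q) :
    fib e (fsum e A A) y = Icc (-((q - p)/2)) ((q - p)/2) := by
  rw [fib_fsum he _ _ hy, h, avg_Icc hpq hpq]
  congr 1; ring

theorem fib_fsum_empty {e : E} (he : ‖e‖ = 1) {A : Set E} {y : E} (hy : ⟪e, y⟫ = (0:ℝ))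
    (h : fib e A y = ∅) : fib e (fsum e A A) y = ∅ := by
  rw [fib_fsum he _ _ hy, h]; simp

theorem inner_perp_zero {e : E} (y : (Submodule.span ℝ {e})ᗮ) : ⟪e, (y : E)⟫ = (0 : ℝ) :=
  (Submodule.mem_orthogonal_singleton_iff_inner_right.1 y.2)

end Stein

section SteinVol
variable {E : Type*} [NormedAddCommGroup E] [InnerProductSpace ℝ E] [FiniteDimensional ℝ E]
  [MeasurableSpace E] [BorelSpace E]

theorem volume_fib {e : E} (he : ‖e‖ = 1) {S : Set E} (hS : MeasurableSet S) :
    volume S = ∫⁻ y : (Submodule.span ℝ {e})ᗮ, volume (fib e S y) := volume_fiber he hS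

theorem volume_fsum_self {e : E} (he : ‖e‖ = 1) {A : Set E} (hA : IsCompact A) (hA' : Convex ℝ A) :
    volume (fsum e A A) = volume A := by
  rw [volume_fiber he (fsum_compact e hA hA).measurableSet, volume_fiber he hA.measurableSet]
  refine lintegral_congr fun y => ?_
  change volume (fib e _ _) = volume (fib e _ _)
  rcases fib_cases he hA hA' (y : E) with h | ⟨p, q, hpq, h⟩
  · rw [fib_fsum_empty he (inner_perp_zero y) h, h]
  · rw [fib_fsum_self he (inner_perp_zero y) hpq h, h, Real.volume_Icc, Real.volume_Icc]
    congr 1; ring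

theorem measurable_fib {e : E} {A : Set E} (hA : MeasurableSet A) :
    Measurable fun y : (Submodule.span ℝ {e})ᗮ => volume (fib e A y) := by
  have : MeasurableSet {q : (Submodule.span ℝ {e})ᗮ × ℝ | (q.1 : E) + q.2 • e ∈ A} :=
    (by fun_prop : Measurable fun q : (Submodule.span ℝ {e})ᗮ × ℝ => (q.1 : E) + q.2 • e) hA
  exact measurable_measure_prodMk_left this

theorem volume_fsum_le {e : E} (he : ‖e‖ = 1) {A B : Set E} (hA : IsCompact A) (hA' : Convex ℝ A)
    (hB : IsCompact B) (hB' : Convex ℝ B) :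
    2 * volume (fsum e A B) ≤ volume A + volume B := by
  rw [volume_fib he (fsum_compact e hA hB).measurableSet, volume_fib he hA.measurableSet,
    volume_fib he hB.measurableSet, ← lintegral_const_mul' _ _ (by norm_num),
    ← lintegral_add_left (measurable_fib hA.measurableSet)]
  refine lintegral_mono fun y => ?_
  change 2 * volume (fib e _ _) ≤ volume (fib e _ _) + volume (fib e _ _)
  rw [fib_fsum he _ _ (inner_perp_zero y)]
  rcases fib_cases he hA hA' (y : E) with h | ⟨p, q, hpq, h⟩
  · simp [h]
  rcases fib_cases he hB hB' (y : E) with h2 | ⟨p2, q2, hpq2, h2⟩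
  · simp [h2]
  rw [h, h2, avg_Icc hpq hpq2]
  simp only [Real.volume_Icc]
  rw [← ENNReal.ofReal_add (by linarith) (by linarith),
    show (2 : ℝ≥0∞) = ENNReal.ofReal 2 by simp, ← ENNReal.ofReal_mul (by norm_num)]
  exact ENNReal.ofReal_le_ofReal (by linarith)

end SteinVol

section Phi
variable {E : Type*} [NormedAddCommGroup E] [InnerProductSpace ℝ E] [FiniteDimensional ℝ E]
  [MeasurableSpace E] [BorelSpace E]

/-- The averaged sweep volume. -/
noncomputable def Phi (K L : Set E) : ℝ≥0∞ := ∫⁻ x in L, volume (sweep K x)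

theorem measurable_sweep {K : Set E} (hK : IsCompact K) :
    Measurable fun x : E => volume (sweep K x) := by
  have : IsClosed {q : E × E | q.2 ∈ sweep K q.1} := by
    have h : {q : E × E | q.2 ∈ sweep K q.1} =
        Prod.fst '' {r : (E × E) × ℝ | r.2 ∈ Icc (0:ℝ) 1 ∧ r.1.2 - r.2 • r.1.1 ∈ K} := by
      ext ⟨x, z⟩
      simp only [mem_ofPred_eq, mem_sweep, mem_image, Prod.exists, exists_and_right, exists_eq_right]
      constructor
      · rintro ⟨k, hk, t, ht, rfl⟩
        exact ⟨t, ht, by simpa using hk⟩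
      · rintro ⟨t, ht, h⟩
        exact ⟨_, h, t, ht, by simp⟩
    rw [h]
    have hc : IsClosed {r : (E × E) × Icc (0:ℝ) 1 | r.1.2 - (r.2 : ℝ) • r.1.1 ∈ K} :=
      hK.isClosed.preimage (by fun_prop)
    have := isClosedMap_fst_of_compactSpace (X := E × E) (Y := Icc (0:ℝ) 1) _ hc
    convert this using 1
    ext x
    constructor
    · rintro ⟨⟨⟨a, b⟩, t⟩, ⟨ht, h⟩, hx⟩
      exact ⟨⟨⟨a, b⟩, ⟨t, ht⟩⟩, h, hx⟩
    · rintro ⟨⟨⟨a, b⟩, ⟨t, ht⟩⟩, h, hx⟩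
      exact ⟨⟨⟨a, b⟩, t⟩, ⟨ht, h⟩, hx⟩
  exact measurable_measure_prodMk_left this.measurableSet

theorem Phi_fib {e : E} (he : ‖e‖ = 1) {K L : Set E} (hK : IsCompact K) (hL : IsCompact L) :
    Phi K L = ∫⁻ y : (Submodule.span ℝ {e})ᗮ,
      ∫⁻ s in fib e L y, volume (sweep K ((y : E) + s • e)) := by
  rw [Phi, ← lintegral_indicator hL.measurableSet,
    lintegral_fiber he ((measurable_sweep hK).indicator hL.measurableSet)]
  refine lintegral_congr fun y => ?_
  rw [← lintegral_indicator (fib_compact he hL _).measurableSet]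
  rfl

theorem lint_symm (H : ℝ → ℝ≥0∞) (hH : Measurable H) (p q : ℝ) (G : ℝ → ℝ≥0∞)
    (h : ∀ s, 2 * G s ≤ H ((p + q)/2 + s) + H ((p+q)/2 - s)) :
    ∫⁻ s in Icc (-((q-p)/2)) ((q-p)/2), G s ≤ ∫⁻ s in Icc p q, H s := by
  have h1 : ∫⁻ s in Icc (-((q-p)/2)) ((q-p)/2), H ((p + q)/2 + s) = ∫⁻ s in Icc p q, H s := by
    have := (measurePreserving_add_left (volume : Measure ℝ) ((p+q)/2)).setLIntegral_comp_preimage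
      (s := Icc p q) measurableSet_Icc hH
    rw [← this]
    congr 2
    ext s
    simp only [mem_preimage, mem_Icc]
    constructor <;> rintro ⟨h1, h2⟩ <;> constructor <;> linarith
  have h2 : ∫⁻ s in Icc (-((q-p)/2)) ((q-p)/2), H ((p + q)/2 - s) = ∫⁻ s in Icc p q, H s := by
    have := ((volume : Measure ℝ).measurePreserving_sub_left ((p+q)/2)).setLIntegral_comp_preimage
      (s := Icc p q) measurableSet_Icc hH
    rw [← this]
    congr 2
    ext s
    simp only [mem_preimage, mem_Icc]
    constructor <;> rintro ⟨h1, h2⟩ <;> constructor <;> linarith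
  have h3 : 2 * ∫⁻ s in Icc (-((q-p)/2)) ((q-p)/2), G s ≤ 2 * ∫⁻ s in Icc p q, H s := by
    rw [← lintegral_const_mul' _ _ (by norm_num)]
    calc _ ≤ ∫⁻ s in Icc (-((q-p)/2)) ((q-p)/2), (H ((p + q)/2 + s) + H ((p+q)/2 - s)) :=
          lintegral_mono fun s => h s
      _ = _ := by
        rw [lintegral_add_left (by fun_prop), h1, h2, two_mul]
  exact (ENNReal.mul_le_mul_iff_right (by norm_num) (by norm_num)).1 h3

theorem Phi_fsum_le {e : E} (he : ‖e‖ = 1) {K L : Set E} (hK : IsCompact K) (hK' : Convex ℝ K)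
    (hL : IsCompact L) (hL' : Convex ℝ L) :
    Phi (fsum e K K) (fsum e L L) ≤ Phi K L := by
  rw [Phi_fib he hK hL, Phi_fib he (fsum_compact e hK hK) (fsum_compact e hL hL)]
  refine lintegral_mono fun y => ?_
  have hy := inner_perp_zero y
  rcases fib_cases he hL hL' (y : E) with h | ⟨p, q, hpq, h⟩
  · rw [fib_fsum_empty he hy h]; simp
  rw [fib_fsum_self he hy hpq h, h]
  refine lint_symm (fun s => volume (sweep K ((y:E) + s • e)))
    ((measurable_sweep hK).comp (by fun_prop)) p q _ ?_
  intro s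
  have hee := inner_self_one he
  have h1 : (y : E) + s • e = (1/2 : ℝ) • (((y:E) + ((p+q)/2 + s) • e) +
      rfL e ((y:E) + ((p+q)/2 - s) • e)) := by
    simp only [rfL_apply, inner_add_right, inner_smul_right, hee, hy]; module
  have h2 : perpL e ((y:E) + ((p+q)/2 + s) • e) = perpL e ((y:E) + ((p+q)/2 - s) • e) := by
    simp only [perpL_apply, inner_add_right, inner_smul_right, hee, hy]; module
  refine le_trans ?_ (volume_fsum_le he (sweep_compact hK _) (sweep_convex hK' _)
    (sweep_compact hK _) (sweep_convex hK' _))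
  gcongr
  rw [h1]
  exact sweep_fsum e K h2

/-- The weighted measure used to detect symmetry. -/
noncomputable def wt (R : ℝ) : Measure E := volume.withDensity fun x => ENNReal.ofReal (R^2 - ‖x‖^2)

theorem wt_fib {e : E} (he : ‖e‖ = 1) (R : ℝ) {K : Set E} (hK : IsCompact K) :
    wt R K = ∫⁻ y : (Submodule.span ℝ {e})ᗮ,
      ∫⁻ s in fib e K y, ENNReal.ofReal (R^2 - ‖(y:E)‖^2 - s^2) := by
  rw [wt, withDensity_apply _ hK.measurableSet, ← lintegral_indicator hK.measurableSet,
    lintegral_fiber he ((by fun_prop : Measurable _).indicator hK.measurableSet)]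
  refine lintegral_congr fun y => ?_
  rw [← lintegral_indicator (fib_compact he hK _).measurableSet]
  refine lintegral_congr fun s => ?_
  simp only [indicator]
  have : ‖(y:E) + s • e‖^2 = ‖(y:E)‖^2 + s^2 := by
    rw [norm_add_sq_real, inner_smul_right, real_inner_comm, inner_perp_zero y, norm_smul, he]
    simp
  rw [this, ← sub_sub]
  rfl

theorem int_quad (c p q : ℝ) (hpq : p ≤ q) (hp : p^2 ≤ c) (hq : q^2 ≤ c) :
    ∫⁻ s in Icc p q, ENNReal.ofReal (c - s^2) = ENNReal.ofReal (c * (q - p) - (q^3 - p^3)/3) := by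
  rw [← ofReal_integral_eq_lintegral_ofReal]
  · rw [integral_Icc_eq_integral_Ioc, ← intervalIntegral.integral_of_le hpq,
      intervalIntegral.integral_sub (by simp) (by simp)]
    simp
    ring_nf
  · exact (Continuous.integrableOn_Icc (by fun_prop))
  · filter_upwards [ae_restrict_mem measurableSet_Icc] with s hs
    obtain ⟨h1, h2⟩ := hs
    simp only [Pi.zero_apply, sub_nonneg]
    rcases le_total 0 s with h | h
    · nlinarith
    · nlinarith

theorem wt_fsum {e : E} (he : ‖e‖ = 1) {R : ℝ} {K : Set E} (hK : IsCompact K)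
    (hK' : Convex ℝ K) (hR : K ⊆ Metric.closedBall 0 R) :
    wt R K ≤ wt R (fsum e K K) ∧
      (wt R (fsum e K K) ≤ wt R K → volume (K \ rfL e ⁻¹' K) = 0) := by
  have hee := inner_self_one he
  have key : ∀ y : (Submodule.span ℝ {e})ᗮ, ∀ p q : ℝ, p ≤ q → fib e K y = Icc p q →
      ∫⁻ s in fib e K y, ENNReal.ofReal (R^2 - ‖(y:E)‖^2 - s^2) =
        ENNReal.ofReal ((R^2 - ‖(y:E)‖^2) * (q - p) - (q^3 - p^3)/3) ∧
      ∫⁻ s in fib e (fsum e K K) y, ENNReal.ofReal (R^2 - ‖(y:E)‖^2 - s^2) =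
        ENNReal.ofReal ((R^2 - ‖(y:E)‖^2) * (q - p) - 2 * ((q - p)/2)^3/3) ∧
      2 * ((q-p)/2)^3 / 3 ≤ (R^2 - ‖(y:E)‖^2) * (q - p) ∧
      0 ≤ (R^2 - ‖(y:E)‖^2) * (q - p) - (q^3 - p^3)/3 := by
    intro y p q hpq h
    have hb : ∀ s ∈ Icc p q, s^2 ≤ R^2 - ‖(y:E)‖^2 := by
      intro s hs
      rw [← h] at hs
      have := hR hs
      rw [mem_closedBall_zero_iff] at this
      have h2 : ‖(y:E) + s • e‖^2 = ‖(y:E)‖^2 + s^2 := by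
        rw [norm_add_sq_real, inner_smul_right, real_inner_comm, inner_perp_zero y, norm_smul, he]
        simp
      have h3 : ‖(y:E) + s • e‖^2 ≤ R^2 := by
        have := norm_nonneg ((y:E) + s • e)
        gcongr
      linarith
    have hp := hb p ⟨le_rfl, hpq⟩
    have hq := hb q ⟨hpq, le_rfl⟩
    have hm : ((q - p)/2)^2 ≤ R^2 - ‖(y:E)‖^2 := by nlinarith [sq_nonneg (p+q)]
    rw [fib_fsum_self he (inner_perp_zero y) hpq h, h, int_quad _ _ _ hpq hp hq,
      int_quad _ _ _ (by linarith) (by simpa using hm) hm]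
    refine ⟨rfl, by congr 1; ring, ?_, ?_⟩
    · nlinarith
    · have h1 : q * p ≤ R^2 - ‖(y:E)‖^2 := by nlinarith [sq_nonneg (q - p)]
      have h2 := mul_nonneg (sub_nonneg.2 hpq)
        (by linarith : 0 ≤ 3 * (R^2 - ‖(y:E)‖^2) - (q^2 + q * p + p^2))
      nlinarith
  have hle : ∀ y : (Submodule.span ℝ {e})ᗮ,
      ∫⁻ s in fib e K y, ENNReal.ofReal (R^2 - ‖(y:E)‖^2 - s^2) ≤
      ∫⁻ s in fib e (fsum e K K) y, ENNReal.ofReal (R^2 - ‖(y:E)‖^2 - s^2) := by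
    intro y
    rcases fib_cases he hK hK' (y : E) with h | ⟨p, q, hpq, h⟩
    · rw [h]; simp
    obtain ⟨h1, h2, -⟩ := key y p q hpq h
    rw [h1, h2]
    refine ENNReal.ofReal_le_ofReal ?_
    nlinarith [mul_nonneg (sub_nonneg.2 hpq) (sq_nonneg (p + q))]
  have hmeas : ∀ A : Set E, IsCompact A → Measurable fun y : (Submodule.span ℝ {e})ᗮ =>
      ∫⁻ s in fib e A y, ENNReal.ofReal (R^2 - ‖(y:E)‖^2 - s^2) := by
    intro A hA
    have : MeasurableSet {q : (Submodule.span ℝ {e})ᗮ × ℝ | (q.1 : E) + q.2 • e ∈ A} :=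
      (by fun_prop : Measurable fun q : (Submodule.span ℝ {e})ᗮ × ℝ => (q.1 : E) + q.2 • e)
        hA.measurableSet
    have h2 : Measurable fun q : (Submodule.span ℝ {e})ᗮ × ℝ =>
      ({q : (Submodule.span ℝ {e})ᗮ × ℝ | (q.1 : E) + q.2 • e ∈ A}).indicator
        (fun q => ENNReal.ofReal (R^2 - ‖(q.1:E)‖^2 - q.2^2)) q :=
      (by fun_prop : Measurable _).indicator this
    convert h2.lintegral_prod_right' (ν := volume) using 2 with y
    rw [← lintegral_indicator (fib_compact he hA _).measurableSet]
    rfl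
  have hfin : wt R K ≠ ∞ := by
    rw [wt, withDensity_apply _ hK.measurableSet]
    have : ∫⁻ x in K, ENNReal.ofReal (R^2 - ‖x‖^2) ≤ ∫⁻ x in K, ENNReal.ofReal (R^2) := by
      refine lintegral_mono fun x => ENNReal.ofReal_le_ofReal ?_
      nlinarith [norm_nonneg x]
    refine ne_top_of_le_ne_top ?_ this
    rw [setLIntegral_const]
    exact ENNReal.mul_ne_top (by simp) hK.measure_lt_top.ne
  refine ⟨?_, fun hge => ?_⟩
  · rw [wt_fib he R hK, wt_fib he R (fsum_compact e hK hK)]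
    exact lintegral_mono hle
  · rw [wt_fib he R hK, wt_fib he R (fsum_compact e hK hK)] at hge
    rw [wt_fib he R hK] at hfin
    have hae := ae_eq_of_ae_le_of_lintegral_le (Filter.Eventually.of_forall hle) hfin
      (hmeas _ (fsum_compact e hK hK)).aemeasurable hge
    rw [volume_fib he (hK.measurableSet.diff ((rfL e).continuous.measurable hK.measurableSet))]
    rw [lintegral_eq_zero_iff (measurable_fib
      (hK.measurableSet.diff ((rfL e).continuous.measurable hK.measurableSet)))]
    filter_upwards [hae] with y hy
    rcases fib_cases he hK hK' (y : E) with h | ⟨p, q, hpq, h⟩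
    · refine measure_mono_null (t := fib e K y) (fun s hs => hs.1) ?_
      rw [h]; simp
    obtain ⟨h1, h2, h3, h3'⟩ := key y p q hpq h
    rw [h1, h2] at hy
    have h4 := (ENNReal.ofReal_eq_ofReal_iff h3' (by linarith)).1 hy
    have h5 : (q - p) * (p + q)^2 = 0 := by nlinarith
    rcases mul_eq_zero.1 h5 with h6 | h6
    · refine measure_mono_null (t := fib e K y) (fun s hs => hs.1) ?_
      rw [h, Real.volume_Icc, h6]; simp
    · have h7 : p = -q := by have := pow_eq_zero_iff (two_ne_zero) |>.1 h6; linarith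
      have hem : fib e (K \ rfL e ⁻¹' K) y = ∅ := ?_
      · show volume (fib e (K \ rfL e ⁻¹' K) y) = 0
        rw [hem]; simp
      rw [eq_empty_iff_forall_notMem]
      rintro s ⟨hs1, hs2⟩
      apply hs2
      have hs1 : s ∈ fib e K y := hs1
      have : -s ∈ fib e K y := by
        rw [h, h7] at *
        exact ⟨by linarith [hs1.2], by linarith [hs1.1]⟩
      show rfL e ((y:E) + s • e) ∈ K
      have h8 : rfL e ((y:E) + s • e) = (y:E) + (-s) • e := by
        simp only [rfL_apply, inner_add_right, inner_smul_right, hee, inner_perp_zero y]; module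
      rw [h8]; exact this

end Phi

section Lim
set_option linter.unusedSectionVars false
open Filter Topology TopologicalSpace
variable {E : Type*} [NormedAddCommGroup E] [InnerProductSpace ℝ E] [FiniteDimensional ℝ E]
  [MeasurableSpace E] [BorelSpace E]

/-- Interior points persist in nearby convex sets. -/
theorem mem_of_near {C D : Set E} (hC : Convex ℝ C) (hC' : IsClosed C) {z : E} {ε : ℝ}
    (hz : Metric.closedBall z ε ⊆ D) (hε : 0 < ε) (h : ∀ c ∈ D, ∃ c' ∈ C, dist c c' < ε) :
    z ∈ C := by
  by_contra hzC
  obtain ⟨f, u, h1, h2⟩ := geometric_hahn_banach_closed_point hC hC' hzC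
  set g := (InnerProductSpace.toDual ℝ E).symm f with hg
  have hfg : ∀ x, f x = ⟪g, x⟫ := fun x => by
    rw [hg, InnerProductSpace.toDual_symm_apply]
  obtain ⟨c0, hc0, -⟩ := h z (hz (Metric.mem_closedBall_self hε.le))
  have hg0 : g ≠ 0 := by
    intro h0
    have := (h1 c0 hc0).trans h2
    rw [hfg, hfg, h0] at this
    simp at this
  have hgn : 0 < ‖g‖ := norm_pos_iff.2 hg0
  obtain ⟨c, hc, hd⟩ := h (z + (ε / ‖g‖) • g) (hz (by
    rw [Metric.mem_closedBall, dist_eq_norm, add_sub_cancel_left, norm_smul, Real.norm_eq_abs,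
      abs_of_pos (by positivity), div_mul_cancel₀ _ hgn.ne']))
  have h3 := (h1 c hc).trans h2
  rw [hfg, hfg] at h3
  have h4 : ⟪g, z + (ε / ‖g‖) • g - c⟫ ≤ ‖g‖ * dist (z + (ε / ‖g‖) • g) c := by
    rw [dist_eq_norm]; exact real_inner_le_norm _ _
  rw [inner_sub_right, inner_add_right, inner_smul_right, real_inner_self_eq_norm_sq] at h4
  have h5 : ε / ‖g‖ * ‖g‖^2 = ε * ‖g‖ := by field_simp
  rw [h5] at h4
  nlinarith

theorem convex_volume_interior {C : Set E} (hC : Convex ℝ C) : volume (interior C) = volume C :=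
  measure_congr (interior_ae_eq_of_null_frontier (hC.addHaar_frontier volume))

/-- Lower semicontinuity of volume. -/
theorem volume_le_liminf {C : ℕ → Set E} {D : Set E} (hC : ∀ n, Convex ℝ (C n))
    (hC' : ∀ n, IsCompact (C n)) (hD : Convex ℝ D)
    (h : ∀ ε > 0, ∀ᶠ n in atTop, ∀ c ∈ D, ∃ c' ∈ C n, dist c c' < ε) :
    volume D ≤ liminf (fun n => volume (C n)) atTop := by
  rw [← convex_volume_interior hD, ← lintegral_indicator_one isOpen_interior.measurableSet]
  calc _ ≤ ∫⁻ x, liminf (fun n => (C n).indicator (1 : E → ℝ≥0∞) x) atTop := by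
        refine lintegral_mono fun x => ?_
        by_cases hx : x ∈ interior D
        · obtain ⟨ε, hε, hb⟩ := Metric.nhds_basis_closedBall.mem_iff.1 (mem_interior_iff_mem_nhds.1 hx)
          have : ∀ᶠ n in atTop, x ∈ C n := by
            filter_upwards [h ε hε] with n hn
            exact mem_of_near (hC n) (hC' n).isClosed hb hε hn
          rw [indicator_of_mem hx]
          refine le_liminf_of_le (by isBoundedDefault) ?_
          filter_upwards [this] with n hn
          rw [indicator_of_mem hn]
        · rw [indicator_of_notMem hx]; exact zero_le
    _ ≤ _ := lintegral_liminf_le fun n => measurable_one.indicator (hC' n).measurableSet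
    _ = _ := by
      congr 1
      ext n
      rw [lintegral_indicator_one (hC' n).measurableSet]

theorem Phi_le_liminf {K L : ℕ → Set E} {K' L' : Set E} (hK : ∀ n, Convex ℝ (K n))
    (hKc : ∀ n, IsCompact (K n)) (hL : ∀ n, Convex ℝ (L n))
    (hLc : ∀ n, IsCompact (L n)) (hK' : Convex ℝ K') (hL' : Convex ℝ L')
    (h : ∀ ε > 0, ∀ᶠ n in atTop, ∀ c ∈ K', ∃ c' ∈ K n, dist c c' < ε)
    (h2 : ∀ ε > 0, ∀ᶠ n in atTop, ∀ c ∈ L', ∃ c' ∈ L n, dist c c' < ε) :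
    Phi K' L' ≤ liminf (fun n => Phi (K n) (L n)) atTop := by
  have e1 : Phi K' L' = ∫⁻ x in interior L', volume (sweep K' x) := by
    rw [Phi]
    exact setLIntegral_congr (interior_ae_eq_of_null_frontier (hL'.addHaar_frontier volume)).symm
  rw [e1, ← lintegral_indicator isOpen_interior.measurableSet]
  calc _ ≤ ∫⁻ x, liminf (fun n => (L n).indicator (fun x => volume (sweep (K n) x)) x) atTop := by
        refine lintegral_mono fun x => ?_
        by_cases hx : x ∈ interior L'
        · obtain ⟨ε, hε, hb⟩ := Metric.nhds_basis_closedBall.mem_iff.1 (mem_interior_iff_mem_nhds.1 hx)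
          have : ∀ᶠ n in atTop, x ∈ L n := by
            filter_upwards [h2 ε hε] with n hn
            exact mem_of_near (hL n) (hLc n).isClosed hb hε hn
          rw [indicator_of_mem hx]
          have h3 : volume (sweep K' x) ≤ liminf (fun n => volume (sweep (K n) x)) atTop := by
            refine volume_le_liminf (fun n => sweep_convex (hK n) x)
              (fun n => sweep_compact (hKc n) x) (sweep_convex hK' x) ?_
            intro δ hδ
            filter_upwards [h δ hδ] with n hn c hc
            obtain ⟨k, hk, t, ht, rfl⟩ := mem_sweep.1 hc
            obtain ⟨k', hk', hd⟩ := hn k hk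
            exact ⟨k' + t • x, mem_sweep.2 ⟨k', hk', t, ht, rfl⟩, by simpa using hd⟩
          refine h3.trans (le_of_eq (liminf_congr ?_))
          filter_upwards [this] with n hn
          rw [indicator_of_mem hn]
        · rw [indicator_of_notMem hx]; exact zero_le
    _ ≤ _ := lintegral_liminf_le fun n => (measurable_sweep (hKc n)).indicator (hLc n).measurableSet
    _ = _ := by
      congr 1
      ext n
      rw [lintegral_indicator (hLc n).measurableSet, Phi]

theorem near_of_tendsto {K : ℕ → NonemptyCompacts E} {K' : NonemptyCompacts E}
    (h : Tendsto K atTop (𝓝 K')) {ε : ℝ} (hε : 0 < ε) :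
    ∀ᶠ n in atTop, (∀ c ∈ K', ∃ c' ∈ K n, dist c c' < ε) ∧ (∀ c ∈ K n, ∃ c' ∈ K', dist c c' < ε) := by
  have := (Metric.tendsto_nhds.1 h) ε hε
  filter_upwards [this] with n hn
  rw [Metric.NonemptyCompacts.dist_eq] at hn
  have fin : Metric.hausdorffEDist (K n : Set E) K' ≠ ⊤ :=
    Metric.hausdorffEDist_ne_top_of_nonempty_of_bounded (K n).nonempty K'.nonempty
      (K n).isCompact.isBounded K'.isCompact.isBounded
  constructor
  · intro c hc
    obtain ⟨y, hy, hd⟩ := Metric.exists_dist_lt_of_hausdorffDist_lt' hc hn fin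
    exact ⟨y, hy, by rwa [dist_comm]⟩
  · intro c hc
    exact Metric.exists_dist_lt_of_hausdorffDist_lt hc hn fin

theorem mem_of_forall_near {K : Set E} (hK : IsClosed K) {z : E}
    (h : ∀ ε > 0, ∃ c ∈ K, dist z c < ε) : z ∈ K := by
  rw [← hK.closure_eq, Metric.mem_closure_iff]
  exact h

theorem measure_usc (μ : Measure E) [μ.OuterRegular] (K : NonemptyCompacts E) (c : ℝ≥0∞)
    (h : μ K < c) : ∀ᶠ K' : NonemptyCompacts E in 𝓝 K, μ (K' : Set E) < c := by
  obtain ⟨U, hU, hUo, hlt⟩ := (K : Set E).exists_isOpen_lt_of_lt c h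
  have : {K' : NonemptyCompacts E | (K' : Set E) ⊆ U} ∈ 𝓝 K :=
    (NonemptyCompacts.isOpen_subsets_of_isOpen hUo).mem_nhds hU
  filter_upwards [this] with K' hK'
  exact (measure_mono hK').trans_lt hlt

/-- Admissible pairs. -/
def admis (R : ℝ) (a b c : ℝ≥0∞) : Set (NonemptyCompacts E × NonemptyCompacts E) :=
  {q | ((q.1 : Set E) ⊆ Metric.closedBall 0 R ∧ (q.2 : Set E) ⊆ Metric.closedBall 0 R) ∧
    Convex ℝ (q.1 : Set E) ∧ Convex ℝ (q.2 : Set E) ∧ a ≤ volume (q.1 : Set E) ∧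
    b ≤ volume (q.2 : Set E) ∧ (q.1 : Set E) - q.1 ⊆ q.2 ∧ Phi (q.1 : Set E) q.2 ≤ c ∧
    volume (q.2 : Set E) ≤ b}

theorem convex_of_tendsto {K : ℕ → NonemptyCompacts E} {K' : NonemptyCompacts E}
    (h : Tendsto K atTop (𝓝 K')) (hc : ∀ n, Convex ℝ (K n : Set E)) : Convex ℝ (K' : Set E) := by
  intro x hx y hy s t hs ht hst
  refine mem_of_forall_near K'.isCompact.isClosed fun ε hε => ?_
  obtain ⟨n, hn1, hn2⟩ := (near_of_tendsto h (half_pos hε)).exists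
  obtain ⟨x', hx', hdx⟩ := hn1 x hx
  obtain ⟨y', hy', hdy⟩ := hn1 y hy
  obtain ⟨z, hz, hdz⟩ := hn2 _ (hc n hx' hy' hs ht hst)
  refine ⟨z, hz, ?_⟩
  have : dist (s • x + t • y) (s • x' + t • y') ≤ ε / 2 := by
    rw [dist_eq_norm]
    have e : s • x + t • y - (s • x' + t • y') = s • (x - x') + t • (y - y') := by module
    rw [e]
    refine (norm_add_le _ _).trans ?_
    rw [norm_smul, norm_smul, ← dist_eq_norm, ← dist_eq_norm, Real.norm_of_nonneg hs,
      Real.norm_of_nonneg ht]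
    have : ε / 2 = s * (ε/2) + t * (ε/2) := by rw [← add_mul, hst, one_mul]
    rw [this]
    gcongr
  calc _ ≤ dist (s • x + t • y) (s • x' + t • y') + dist (s • x' + t • y') z := dist_triangle _ _ _
    _ < ε := by linarith

theorem admis_compact (R : ℝ) (a b c : ℝ≥0∞) : IsCompact (admis (E := E) R a b c) := by
  have hB : IsCompact {K : NonemptyCompacts E | (K : Set E) ⊆ Metric.closedBall 0 R} :=
    NonemptyCompacts.isCompact_subsets_of_isCompact (isCompact_closedBall 0 R)
  refine (hB.prod hB).of_isClosed_subset ?_ (fun q hq => hq.1)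
  refine IsSeqClosed.isClosed ?_
  intro q q' hq hlim
  have h1 : Tendsto (fun n => (q n).1) atTop (𝓝 q'.1) := (continuous_fst.tendsto q').comp hlim
  have h2 : Tendsto (fun n => (q n).2) atTop (𝓝 q'.2) := (continuous_snd.tendsto q').comp hlim
  have hcl : q' ∈ {K : NonemptyCompacts E | (K : Set E) ⊆ Metric.closedBall 0 R} ×ˢ
      {K : NonemptyCompacts E | (K : Set E) ⊆ Metric.closedBall 0 R} :=
    (hB.prod hB).isClosed.mem_of_tendsto hlim (Eventually.of_forall fun n => (hq n).1)
  have c1 := convex_of_tendsto h1 (fun n => (hq n).2.1)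
  have c2 := convex_of_tendsto h2 (fun n => (hq n).2.2.1)
  refine ⟨hcl, c1, c2, ?_, ?_, ?_, ?_, ?_⟩
  · by_contra! hlt
    obtain ⟨n, hn⟩ := (h1.eventually (measure_usc volume _ _ hlt)).exists
    exact absurd (hq n).2.2.2.1 (not_le.2 hn)
  · by_contra! hlt
    obtain ⟨n, hn⟩ := (h2.eventually (measure_usc volume _ _ hlt)).exists
    exact absurd (hq n).2.2.2.2.1 (not_le.2 hn)
  · rintro _ ⟨x, hx, y, hy, rfl⟩
    refine mem_of_forall_near q'.2.isCompact.isClosed fun ε hε => ?_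
    have hε3 : 0 < ε / 3 := by linarith
    obtain ⟨n, ⟨hn1, hn2⟩, hn3, hn4⟩ := ((near_of_tendsto h1 hε3).and (near_of_tendsto h2 hε3)).exists
    obtain ⟨x', hx', hdx⟩ := hn1 x hx
    obtain ⟨y', hy', hdy⟩ := hn1 y hy
    obtain ⟨z, hz, hdz⟩ := hn4 _ ((hq n).2.2.2.2.2.1 (sub_mem_sub hx' hy'))
    refine ⟨z, hz, ?_⟩
    have h5 := dist_triangle (x - y) (x' - y') z
    have h6 := dist_sub_sub_le x y x' y'
    show dist (x - y) z < ε
    linarith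
  · refine (Phi_le_liminf (fun n => (hq n).2.1) (fun n => (q n).1.isCompact)
      (fun n => (hq n).2.2.1) (fun n => (q n).2.isCompact) c1 c2 ?_ ?_).trans ?_
    · intro ε hε
      filter_upwards [near_of_tendsto h1 hε] with n hn using hn.1
    · intro ε hε
      filter_upwards [near_of_tendsto h2 hε] with n hn using hn.1
    · refine (liminf_le_liminf (Eventually.of_forall fun n => (hq n).2.2.2.2.2.2.1)).trans ?_
      simp
  · refine (volume_le_liminf (fun n => (hq n).2.2.1) (fun n => (q n).2.isCompact) c2 ?_).trans ?_
    · intro ε hε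
      filter_upwards [near_of_tendsto h2 hε] with n hn using hn.1
    · refine (liminf_le_liminf (Eventually.of_forall fun n => (hq n).2.2.2.2.2.2.2)).trans ?_
      simp

theorem wt_finite (R : ℝ) : IsFiniteMeasure (wt R : Measure E) := by
  refine ⟨?_⟩
  rw [wt, withDensity_apply _ MeasurableSet.univ, setLIntegral_univ]
  have : ∫⁻ x : E, ENNReal.ofReal (R^2 - ‖x‖^2) ≤
      ∫⁻ x in Metric.closedBall (0:E) |R|, ENNReal.ofReal (R^2) := by
    rw [← lintegral_indicator measurableSet_closedBall]
    refine lintegral_mono fun x => ?_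
    by_cases hx : x ∈ Metric.closedBall (0:E) |R|
    · rw [indicator_of_mem hx]
      exact ENNReal.ofReal_le_ofReal (by nlinarith [norm_nonneg x])
    · rw [indicator_of_notMem hx]
      rw [mem_closedBall_zero_iff, not_le] at hx
      rw [ENNReal.ofReal_of_nonpos]
      rw [← sq_abs R]
      nlinarith [abs_nonneg R]
  refine this.trans_lt ?_
  rw [setLIntegral_const]
  exact ENNReal.mul_lt_top (by simp) measure_closedBall_lt_top

theorem interior_nonempty_of_volume {C : Set E} (hC : Convex ℝ C) (h : 0 < volume C) :
    (interior C).Nonempty := by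
  rw [← convex_volume_interior hC] at h
  exact nonempty_of_measure_ne_zero h.ne'

theorem refl_symm {e : E} {K : Set E} (hK : IsCompact K) (hK' : Convex ℝ K) (hv : 0 < volume K)
    (h : volume (K \ rfL e ⁻¹' K) = 0) : K ⊆ rfL e ⁻¹' K := by
  have hcl : IsClosed (rfL e ⁻¹' K) := hK.isClosed.preimage (rfL e).continuous
  have h0 : volume (interior K \ rfL e ⁻¹' K) = 0 :=
    measure_mono_null (sdiff_subset_sdiff_left interior_subset) h
  have h1 : interior K \ rfL e ⁻¹' K = ∅ :=
    (IsOpen.sdiff isOpen_interior hcl).measure_eq_zero_iff volume |>.1 h0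
  have h2 : closure (interior K) ⊆ rfL e ⁻¹' K :=
    closure_minimal (sdiff_eq_empty.1 h1) hcl
  rwa [hK'.closure_interior_eq_closure_of_nonempty_interior (interior_nonempty_of_volume hK' hv),
    hK.isClosed.closure_eq] at h2

theorem ball_of_symm {K : Set E} (hK : IsCompact K) (hK' : Convex ℝ K) (hne : K.Nonempty)
    (h : ∀ e : E, ‖e‖ = 1 → K ⊆ rfL e ⁻¹' K) : ∃ r : ℝ, 0 ≤ r ∧ K = Metric.closedBall 0 r := by
  obtain ⟨p, hp, hmax⟩ := hK.exists_isMaxOn hne (f := fun x => ‖x‖) (by fun_prop)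
  refine ⟨‖p‖, norm_nonneg p, ?_⟩
  have hs : ∀ x, ‖x‖ = ‖p‖ → x ∈ K := by
    intro x hx
    by_cases hxp : p = x
    · rwa [← hxp]
    have hn : 0 < ‖p - x‖ := norm_pos_iff.2 (sub_ne_zero.2 hxp)
    set e := (1 / ‖p - x‖) • (p - x) with he
    have he1 : ‖e‖ = 1 := by
      rw [he, norm_smul, Real.norm_of_nonneg (by positivity), one_div, inv_mul_cancel₀ hn.ne']
    have := h e he1 hp
    have h3 : rfL e p = x := by
      rw [rfL_apply, he, inner_smul_left, smul_smul]
      have h5 : 2 * ⟪p - x, p⟫ = ‖p - x‖^2 := by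
        rw [norm_sub_sq_real, inner_sub_left, real_inner_self_eq_norm_sq, hx, real_inner_comm]; ring
      have h4 : 2 * ((starRingEnd ℝ) (1 / ‖p - x‖) * ⟪p - x, p⟫) * (1 / ‖p - x‖) = 1 := by
        simp only [conj_trivial]
        field_simp
        rw [h5]
      rw [h4]; simp
    rwa [mem_preimage, h3] at this
  refine Subset.antisymm (fun x hx => by rw [mem_closedBall_zero_iff]; exact hmax hx) ?_
  intro x hx
  rw [mem_closedBall_zero_iff] at hx
  by_cases hx0 : x = 0
  · have h1 := hs (-p) (norm_neg p)
    have := hK' hp h1 (by norm_num : (0:ℝ) ≤ 1/2) (by norm_num : (0:ℝ) ≤ 1/2) (by norm_num)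
    rw [hx0]
    convert this using 1
    module
  · have hn : 0 < ‖x‖ := norm_pos_iff.2 hx0
    have h1 := hs ((‖p‖/‖x‖) • x) (by rw [norm_smul, Real.norm_of_nonneg (by positivity)]; field_simp)
    have h2 := hs (-((‖p‖/‖x‖) • x)) (by rw [norm_neg, norm_smul, Real.norm_of_nonneg (by positivity)]; field_simp)
    have hp0 : 0 < ‖p‖ := hn.trans_le hx
    have := hK' h1 h2 (a := (1 + ‖x‖/‖p‖)/2) (b := (1 - ‖x‖/‖p‖)/2) (by positivity)
      (by have : ‖x‖/‖p‖ ≤ 1 := (div_le_one hp0).2 hx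
          linarith) (by ring)
    convert this using 1
    rw [smul_neg, smul_smul, smul_smul, ← sub_eq_add_neg, ← sub_smul]
    have : (1 + ‖x‖ / ‖p‖) / 2 * (‖p‖ / ‖x‖) - (1 - ‖x‖ / ‖p‖) / 2 * (‖p‖ / ‖x‖) = 1 := by
      field_simp; ring
    rw [this, one_smul]

/-- Symmetrization in the limit. -/
theorem sym_limit {K L : Set E} (hK : IsCompact K) (hK' : Convex ℝ K) (hL : IsCompact L)
    (hL' : Convex ℝ L) (hKv : 0 < volume K) (hLv : 0 < volume L) (hKL : K - K ⊆ L) :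
    ∃ r₁ r₂ : ℝ, 0 ≤ r₁ ∧ 0 ≤ r₂ ∧ volume K ≤ volume (Metric.closedBall (0:E) r₁) ∧
      volume L = volume (Metric.closedBall (0:E) r₂) ∧
      Metric.closedBall (0:E) r₁ - Metric.closedBall (0:E) r₁ ⊆ Metric.closedBall (0:E) r₂ ∧
      Phi (Metric.closedBall (0:E) r₁) (Metric.closedBall (0:E) r₂) ≤ Phi K L := by
  obtain ⟨R, hR⟩ := (hK.isBounded.union hL.isBounded).subset_closedBall 0
  have hKR := subset_union_left.trans hR
  have hLR := subset_union_right.trans hR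
  have hKne : K.Nonempty := nonempty_of_measure_ne_zero hKv.ne'
  have hLne : L.Nonempty := nonempty_of_measure_ne_zero hLv.ne'
  have := wt_finite (E := E) R
  obtain ⟨⟨K₀, L₀⟩, hmem, hmax⟩ := UpperSemicontinuousOn.exists_isMaxOn
    (f := fun q : NonemptyCompacts E × NonemptyCompacts E =>
      wt R (q.1 : Set E) + wt R (q.2 : Set E))
    (s := admis (E := E) R (volume K) (volume L) (Phi K L))
    ⟨⟨⟨⟨K, hK⟩, hKne⟩, ⟨⟨L, hL⟩, hLne⟩⟩, ⟨hKR, hLR⟩, hK', hL', le_rfl, le_rfl, hKL, le_rfl, le_rfl⟩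
    (admis_compact _ _ _ _) (by
      refine UpperSemicontinuousOn.add ?_ ?_
      · intro q _ c hc
        exact (nhdsWithin_le_nhds) ((continuous_fst.tendsto q).eventually (measure_usc (wt R) _ _ hc))
      · intro q _ c hc
        exact (nhdsWithin_le_nhds) ((continuous_snd.tendsto q).eventually (measure_usc (wt R) _ _ hc)))
  obtain ⟨⟨b1, b2⟩, c1, c2, v1, v2, hs, hphi, v3⟩ := hmem
  dsimp only at *
  have key : ∀ e : E, ‖e‖ = 1 → (K₀ : Set E) ⊆ rfL e ⁻¹' K₀ ∧ (L₀ : Set E) ⊆ rfL e ⁻¹' L₀ := by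
    intro e he
    have hk := K₀.isCompact
    have hl := L₀.isCompact
    have hm := hmax (a := (⟨⟨⟨fsum e K₀ K₀, fsum_compact e hk hk⟩, fsum_nonempty e K₀.nonempty⟩,
      ⟨⟨fsum e L₀ L₀, fsum_compact e hl hl⟩, fsum_nonempty e L₀.nonempty⟩⟩ :
        NonemptyCompacts E × NonemptyCompacts E))
      ⟨⟨fsum_ball he b1, fsum_ball he b2⟩, fsum_convex e c1 c1, fsum_convex e c2 c2,
        v1.trans (volume_fsum_self he hk c1).ge, v2.trans (volume_fsum_self he hl c2).ge,
        fsum_sub e _ _ hs, (Phi_fsum_le he hk c1 hl c2).trans hphi,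
        (volume_fsum_self he hl c2).le.trans v3⟩
    replace hm : wt R (fsum e (K₀ : Set E) K₀) + wt R (fsum e (L₀ : Set E) L₀) ≤
      wt R (K₀ : Set E) + wt R (L₀ : Set E) := hm
    obtain ⟨k1, k2⟩ := wt_fsum he hk c1 b1
    obtain ⟨l1, l2⟩ := wt_fsum he hl c2 b2
    refine ⟨refl_symm hk c1 (hKv.trans_le v1) (k2 ?_), refl_symm hl c2 (hLv.trans_le v2) (l2 ?_)⟩
    · exact (ENNReal.add_le_add_iff_right (measure_ne_top _ _)).1
        (hm.trans (add_le_add le_rfl l1))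
    · exact (ENNReal.add_le_add_iff_left (measure_ne_top _ _)).1
        (hm.trans (add_le_add k1 le_rfl))
  obtain ⟨r₁, h1, e1⟩ := ball_of_symm K₀.isCompact c1 K₀.nonempty fun e he => (key e he).1
  obtain ⟨r₂, h2, e2⟩ := ball_of_symm L₀.isCompact c2 L₀.nonempty fun e he => (key e he).2
  rw [e1] at v1 hs hphi
  rw [e2] at v2 hs hphi v3
  exact ⟨r₁, r₂, h1, h2, v1, le_antisymm v2 v3, hs, hphi⟩

end Lim

section Gau
set_option linter.unusedSectionVars false
variable {E : Type*} [NormedAddCommGroup E] [InnerProductSpace ℝ E] [FiniteDimensional ℝ E]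
  [MeasurableSpace E] [BorelSpace E]

/-- Projection of `K` along `u`. -/
def prj (u : E) (K : Set E) : Set (Submodule.span ℝ {u})ᗮ := {y | (fib u K y).Nonempty}

theorem prj_closed {u : E} (hu : ‖u‖ = 1) {K : Set E} (hK : IsCompact K) : IsClosed (prj u K) := by
  have : prj u K = (fun x : E => (Submodule.span ℝ {u})ᗮ.orthogonalProjectionOnto x) '' K := by
    ext y
    constructor
    · rintro ⟨s, hs⟩
      refine ⟨_, hs, ?_⟩
      simp only [map_add, map_smul]
      rw [Submodule.orthogonalProjectionOnto_mem_subspace_eq_self,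
        Submodule.orthogonalProjectionOnto_orthogonal_apply_eq_zero (Submodule.mem_span_singleton_self u)]
      simp
    · rintro ⟨x, hx, rfl⟩
      refine ⟨⟪u, x⟫, ?_⟩
      show _ ∈ K
      convert hx using 1
      have := (Submodule.span ℝ {u}).starProjection_add_starProjection_orthogonal x
      rw [Submodule.starProjection_unit_singleton ℝ hu] at this
      rw [add_comm]
      exact this
  rw [this]
  exact (hK.image (by fun_prop)).isClosed

theorem fib_sweep {u : E} {K : Set E} {y : E} {t : ℝ} (ht : 0 ≤ t) {p q : ℝ}
    (hpq : p ≤ q) (h : fib u K y = Icc p q) : fib u (sweep K (t • u)) y = Icc p (q + t) := by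
  ext s
  have hk : ∀ a, y + a • u ∈ K ↔ a ∈ Icc p q := fun a => by rw [← h]; rfl
  constructor
  · intro hs
    obtain ⟨k, hk', τ, hτ, e⟩ := mem_sweep.1 hs
    have : k = y + (s - τ * t) • u := by
      rw [eq_sub_of_add_eq e]; module
    rw [this, hk] at hk'
    have h1 := mul_nonneg hτ.1 ht
    have h2 := mul_le_of_le_one_left ht hτ.2
    exact ⟨by linarith [hk'.1], by linarith [hk'.2]⟩
  · rintro ⟨h1, h2⟩
    rcases ht.eq_or_lt with rfl | ht
    · exact mem_sweep.2 ⟨y + s • u, (hk _).2 ⟨h1, by linarith⟩, 0, ⟨le_rfl, zero_le_one⟩, by simp⟩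
    rcases le_total s q with h3 | h3
    · exact mem_sweep.2 ⟨y + s • u, (hk _).2 ⟨h1, h3⟩, 0, ⟨le_rfl, zero_le_one⟩, by simp⟩
    · refine mem_sweep.2 ⟨y + q • u, (hk _).2 ⟨hpq, le_rfl⟩, (s - q)/t,
        ⟨div_nonneg (by linarith) ht.le, (div_le_one ht).2 (by linarith)⟩, ?_⟩
      rw [smul_smul, div_mul_cancel₀ _ ht.ne']; module

theorem fib_sweep_empty {u : E} {K : Set E} {y : E} {t : ℝ}
    (h : fib u K y = ∅) : fib u (sweep K (t • u)) y = ∅ := by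
  rw [eq_empty_iff_forall_notMem] at *
  intro s hs
  obtain ⟨k, hk', τ, hτ, e⟩ := mem_sweep.1 hs
  apply h (s - τ * t)
  have : k = y + (s - τ * t) • u := by
    rw [eq_sub_of_add_eq e]; module
  rw [this] at hk'
  exact hk'

theorem volume_sweep {u : E} (hu : ‖u‖ = 1) {K : Set E} (hK : IsCompact K) (hK' : Convex ℝ K)
    {t : ℝ} (ht : 0 ≤ t) :
    volume (sweep K (t • u)) = volume K + ENNReal.ofReal t * volume (prj u K) := by
  have hm := (prj_closed hu hK).measurableSet
  rw [volume_fib hu (sweep_compact hK _).measurableSet, volume_fib hu hK.measurableSet,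
    ← lintegral_indicator_one hm, ← lintegral_const_mul _ (measurable_one.indicator hm),
    ← lintegral_add_left (measurable_fib hK.measurableSet)]
  refine lintegral_congr fun y => ?_
  rcases fib_cases hu hK hK' (y : E) with h | ⟨p, q, hpq, h⟩
  · have : y ∉ prj u K := by
      intro hy; have hy : (fib u K y).Nonempty := hy
      rw [h] at hy; simp at hy
    rw [fib_sweep_empty h, h, indicator_of_notMem this]; simp
  · have : y ∈ prj u K := by
      show (fib u K y).Nonempty
      rw [h]; exact nonempty_Icc.2 hpq
    rw [fib_sweep ht hpq h, h, indicator_of_mem this, Real.volume_Icc, Real.volume_Icc,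
      Pi.one_apply, mul_one, ← ENNReal.ofReal_add (by linarith) ht]
    congr 1; ring

/-- Reflection in the hyperplane `⟪u, x⟫ = h`. -/
noncomputable def rfA (u : E) (h : ℝ) (x : E) : E := x + (2 * (h - ⟪u, x⟫)) • u

theorem hull_compact {A B : Set E} (hA : IsCompact A) (hA' : Convex ℝ A) (hB : IsCompact B)
    (hB' : Convex ℝ B) : IsCompact (convexHull ℝ (A ∪ B)) := by
  rcases A.eq_empty_or_nonempty with rfl | h1
  · rwa [empty_union, hB'.convexHull_eq]
  rcases B.eq_empty_or_nonempty with rfl | h2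
  · rwa [union_empty, hA'.convexHull_eq]
  rw [hA'.convexHull_union hB' h1 h2]
  have : convexJoin ℝ A B = (fun q : (E × E) × ℝ => (1 - q.2) • q.1.1 + q.2 • q.1.2) ''
      ((A ×ˢ B) ×ˢ Icc (0:ℝ) 1) := by
    ext x
    rw [mem_convexJoin]
    constructor
    · rintro ⟨a, ha, b, hb, h⟩
      rw [segment_eq_image] at h
      obtain ⟨t, ht, rfl⟩ := h
      exact ⟨⟨⟨a, b⟩, t⟩, ⟨⟨ha, hb⟩, ht⟩, rfl⟩
    · rintro ⟨⟨⟨a, b⟩, t⟩, ⟨⟨ha, hb⟩, ht⟩, rfl⟩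
      refine ⟨a, ha, b, hb, ?_⟩
      rw [segment_eq_image]
      exact ⟨t, ht, rfl⟩
  rw [this]
  exact ((hA.prod hB).prod isCompact_Icc).image (by fun_prop)

theorem rfA_continuous (u : E) (h : ℝ) : Continuous (rfA u h) := by
  unfold rfA; fun_prop

theorem rfA_convex (u : E) (h : ℝ) {K : Set E} (hK : Convex ℝ K) : Convex ℝ (rfA u h '' K) := by
  rintro _ ⟨x, hx, rfl⟩ _ ⟨y, hy, rfl⟩ s t hs ht hst
  refine ⟨s • x + t • y, hK hx hy hs ht hst, ?_⟩
  simp only [rfA, inner_add_right, inner_smul_right]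
  have : t = 1 - s := by linarith
  subst this
  module

theorem two_hulls {u : E} (hu : ‖u‖ = 1) {K : Set E} (hK : IsCompact K) (hK' : Convex ℝ K)
    {a b : ℝ} (hab : ∀ k ∈ K, a ≤ ⟪u, k⟫ ∧ ⟪u, k⟫ ≤ b) (hle : a ≤ b) :
    2 * (volume K + ENNReal.ofReal (b - a) * volume (prj u K)) ≤
      volume (convexHull ℝ (K ∪ rfA u b '' K)) + volume (convexHull ℝ (K ∪ rfA u a '' K)) := by
  have hm := (prj_closed hu hK).measurableSet
  have huu := inner_self_one hu
  have hcr : ∀ c, IsCompact (convexHull ℝ (K ∪ rfA u c '' K)) := fun c =>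
    hull_compact hK hK' (hK.image (rfA_continuous u c)) (rfA_convex u c hK')
  rw [volume_fib hu (hcr b).measurableSet, volume_fib hu (hcr a).measurableSet,
    volume_fib hu hK.measurableSet,
    ← lintegral_indicator_one hm, ← lintegral_const_mul _ (measurable_one.indicator hm),
    ← lintegral_add_left (measurable_fib hK.measurableSet),
    ← lintegral_const_mul' _ _ (by norm_num),
    ← lintegral_add_left (measurable_fib (hcr b).measurableSet)]
  refine lintegral_mono fun y => ?_
  have hy := inner_perp_zero y
  rcases fib_cases hu hK hK' (y : E) with h | ⟨p, q, hpq, h⟩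
  · have : y ∉ prj u K := by
      intro hy; have hy : (fib u K y).Nonempty := hy
      rw [h] at hy; simp at hy
    rw [h, indicator_of_notMem this]; simp
  · have hyp : y ∈ prj u K := by
      show (fib u K y).Nonempty
      rw [h]; exact nonempty_Icc.2 hpq
    have hk : ∀ s ∈ Icc p q, (y:E) + s • u ∈ K := fun s hs => by rw [← h] at hs; exact hs
    have hin : ∀ s : ℝ, ⟪u, (y:E) + s • u⟫ = s := fun s => by
      rw [inner_add_right, inner_smul_right, hy, huu]; ring
    have hp := hab _ (hk p ⟨le_rfl, hpq⟩)
    have hq := hab _ (hk q ⟨hpq, le_rfl⟩)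
    rw [hin] at hp hq
    have hmem : ∀ c s, s ∈ Icc p q → s ∈ fib u (convexHull ℝ (K ∪ rfA u c '' K)) y ∧
        2 * c - s ∈ fib u (convexHull ℝ (K ∪ rfA u c '' K)) y := by
      intro c s hs
      refine ⟨subset_convexHull ℝ _ (Or.inl (hk s hs)), subset_convexHull ℝ _ (Or.inr ⟨_, hk s hs, ?_⟩)⟩
      rw [rfA, hin]; module
    have hcv : ∀ c, (fib u (convexHull ℝ (K ∪ rfA u c '' K)) y).OrdConnected := fun c =>
      (fib_convex u (convex_convexHull ℝ _) _).ordConnected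
    have s1 : Icc p (2 * b - p) ⊆ fib u (convexHull ℝ (K ∪ rfA u b '' K)) y :=
      (hcv b).out (hmem b p ⟨le_rfl, hpq⟩).1 (hmem b p ⟨le_rfl, hpq⟩).2
    have s2 : Icc (2 * a - q) q ⊆ fib u (convexHull ℝ (K ∪ rfA u a '' K)) y :=
      (hcv a).out (hmem a q ⟨hpq, le_rfl⟩).2 (hmem a q ⟨hpq, le_rfl⟩).1
    refine le_trans (le_of_eq ?_) (add_le_add (measure_mono s1) (measure_mono s2))
    rw [h, indicator_of_mem hyp, Pi.one_apply, mul_one, Real.volume_Icc, Real.volume_Icc,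
      Real.volume_Icc, ← ENNReal.ofReal_add (by linarith) (by linarith),
      ← ENNReal.ofReal_add (by linarith) (by linarith), ← ENNReal.ofReal_ofNat,
      ← ENNReal.ofReal_mul (by norm_num)]
    congr 1; ring

/-- The constant of gauge integrals. -/
noncomputable def kap (n : ℕ) : ℝ≥0∞ := ∫⁻ t in Ioi (0:ℝ), (1 - ENNReal.ofReal t ^ n)

theorem kap_pos {n : ℕ} (hn : n ≠ 0) : 0 < kap n := by
  have : ∫⁻ t in Ioo (0:ℝ) (1/2), (ENNReal.ofReal (1/2)) ≤ kap n := by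
    refine (setLIntegral_mono' measurableSet_Ioo ?_).trans
      (lintegral_mono_set (fun x hx => hx.1 : Ioo (0:ℝ) (1/2) ⊆ Ioi 0))
    intro t ht
    rw [← ENNReal.ofReal_pow ht.1.le, ← ENNReal.ofReal_one, ← ENNReal.ofReal_sub _ (by
      have := ht.1; positivity)]
    refine ENNReal.ofReal_le_ofReal ?_
    have : t ^ n ≤ t := pow_le_of_le_one ht.1.le (by linarith [ht.2]) hn
    linarith [ht.2]
  refine lt_of_lt_of_le ?_ this
  rw [setLIntegral_const, Real.volume_Ioo]
  norm_num

theorem kap_lt_top {n : ℕ} : kap n ≠ ⊤ := by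
  have : kap n ≤ ∫⁻ t in Ioi (0:ℝ), (Icc (0:ℝ) 1).indicator 1 t := by
    refine setLIntegral_mono' measurableSet_Ioi ?_
    intro t ht
    by_cases h : t ≤ 1
    · rw [indicator_of_mem (show t ∈ Icc (0:ℝ) 1 from ⟨le_of_lt ht, h⟩)]; exact tsub_le_self
    · rw [tsub_eq_zero_of_le]
      · exact zero_le
      · have : (1:ℝ≥0∞) ≤ ENNReal.ofReal t := by
          rw [← ENNReal.ofReal_one]; exact ENNReal.ofReal_le_ofReal (by linarith)
        exact one_le_pow₀ this
  refine ne_top_of_le_ne_top ?_ (this.trans (setLIntegral_le_lintegral _ _))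
  rw [lintegral_indicator_one measurableSet_Icc]
  simp

theorem gauge_le_iff {L : Set E} (hL : IsCompact L) (hL' : Convex ℝ L) (h0 : L ∈ nhds (0:E)) {t : ℝ}
    (ht : 0 < t) (x : E) : gauge L x ≤ t ↔ x ∈ t • L := by
  have h1 := gauge_le_one_iff_mem_closure hL' h0 (x := t⁻¹ • x)
  rw [hL.isClosed.closure_eq, gauge_smul_of_nonneg (inv_nonneg.2 ht.le), smul_eq_mul,
    inv_mul_le_one₀ ht] at h1
  rw [h1, mem_smul_set_iff_inv_smul_mem₀ ht.ne']

theorem lint_gauge {L : Set E} (hL : IsCompact L) (hL' : Convex ℝ L) (h0 : L ∈ nhds (0:E)) :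
    ∫⁻ x in L, ENNReal.ofReal (gauge L x) = kap (Module.finrank ℝ E) * volume L := by
  rw [lintegral_eq_lintegral_meas_lt _ (Filter.Eventually.of_forall fun x => gauge_nonneg x)
    (continuous_gauge hL' h0).measurable.aemeasurable, kap, mul_comm,
    ← lintegral_const_mul' _ _ hL.measure_lt_top.ne]
  refine setLIntegral_congr_fun measurableSet_Ioi fun t ht => ?_
  have ht : 0 < t := ht
  have e1 : {a | t < gauge L a} = (t • L)ᶜ := by
    ext x
    rw [mem_compl_iff, ← gauge_le_iff hL hL' h0 ht, not_le]
    rfl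
  have hc : MeasurableSet (t • L) := (hL.smul t).measurableSet
  rw [e1, Measure.restrict_apply hc.compl, ENNReal.mul_sub (fun _ _ => hL.measure_lt_top.ne), mul_one]
  have h2 : volume (t • L) = volume L * ENNReal.ofReal t ^ Module.finrank ℝ E := by
    rw [Measure.addHaar_smul_of_nonneg _ ht.le, mul_comm, ENNReal.ofReal_pow ht.le]
  rw [← h2, inter_comm, ← sdiff_eq]
  rcases le_total t 1 with h | h
  · have : t • L ⊆ L := by
      intro x hx
      rw [← gauge_le_iff hL hL' h0 ht] at hx
      have := (gauge_le_iff hL hL' h0 one_pos x).1 (hx.trans h)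
      rwa [one_smul] at this
    rw [measure_sdiff this hc.nullMeasurableSet (ne_top_of_le_ne_top hL.measure_lt_top.ne (measure_mono this))]
  · have : L ⊆ t • L := by
      intro x hx
      rw [← gauge_le_iff hL hL' h0 ht]
      exact (gauge_le_one_of_mem hx).trans h
    rw [sdiff_eq_empty.2 this, measure_empty, tsub_eq_zero_of_le (measure_mono this)]

end Gau

section Main
set_option linter.unusedSectionVars false
variable {E : Type*} [NormedAddCommGroup E] [InnerProductSpace ℝ E] [FiniteDimensional ℝ E]
  [MeasurableSpace E] [BorelSpace E]

theorem compact_diff {E : Type*} [NormedAddCommGroup E] {K : Set E} (hK : IsCompact K) : IsCompact (K - K) := by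
  rw [← Set.sub_image_prod]; exact (hK.prod hK).image continuous_sub


theorem volume_ball_eq {F : Type*} [NormedAddCommGroup F] [InnerProductSpace ℝ F]
    [FiniteDimensional ℝ F] [MeasurableSpace F] [BorelSpace F] {n : ℕ}
    (h : Module.finrank ℝ F = n) (c : F) {r : ℝ} (hr : 0 ≤ r) :
    volume (Metric.closedBall c r) = ENNReal.ofReal (r ^ n) *
      volume (Metric.closedBall (0 : EuclideanSpace ℝ (Fin n)) 1) := by
  rw [Measure.addHaar_closedBall' _ _ hr, h]
  congr 1
  have f := ((stdOrthonormalBasis ℝ F).reindex (finCongr h)).repr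
  have := f.measurePreserving.measure_preimage
    (Metric.isClosed_closedBall (x := (0 : EuclideanSpace ℝ (Fin n))) (ε := 1)).measurableSet.nullMeasurableSet
  rw [← this]
  congr 1
  ext x
  simp

theorem finrank_perp {u : E} (hu : ‖u‖ = 1) :
    Module.finrank ℝ (Submodule.span ℝ {u})ᗮ = Module.finrank ℝ E - 1 := by
  have h1 := (Submodule.span ℝ {u}).finrank_add_finrank_orthogonal
  have h2 : Module.finrank ℝ (Submodule.span ℝ {u}) = 1 :=
    finrank_span_singleton (by rintro rfl; simp at hu)
  omega

theorem norm_sq_decomp {u : E} (hu : ‖u‖ = 1) (y : (Submodule.span ℝ {u})ᗮ) (s : ℝ) :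
    ‖(y:E) + s • u‖^2 = ‖y‖^2 + s^2 := by
  rw [norm_add_sq_real, inner_smul_right, real_inner_comm, inner_perp_zero y, norm_smul, hu]
  simp

theorem prj_ball {u : E} (hu : ‖u‖ = 1) (c : E) {r : ℝ} (hr : 0 ≤ r) :
    ∃ c', prj u (Metric.closedBall c r) = Metric.closedBall c' r := by
  set c' : (Submodule.span ℝ {u})ᗮ := (Submodule.span ℝ {u})ᗮ.orthogonalProjectionOnto c
  have hc : c = (c' : E) + ⟪u, c⟫ • u := by
    have := (Submodule.span ℝ {u}).starProjection_add_starProjection_orthogonal c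
    rw [Submodule.starProjection_unit_singleton ℝ hu, add_comm] at this
    exact this.symm
  have key : ∀ (y : (Submodule.span ℝ {u})ᗮ) (s : ℝ), ‖(y:E) + s • u - c‖^2 =
      ‖y - c'‖^2 + (s - ⟪u, c⟫)^2 := by
    intro y s
    rw [← norm_sq_decomp hu]
    congr 2
    nth_rewrite 1 [hc]
    push_cast
    module
  refine ⟨c', ?_⟩
  ext y
  rw [Metric.mem_closedBall, dist_eq_norm]
  constructor
  · rintro ⟨s, hs⟩
    have hs : (y:E) + s • u ∈ Metric.closedBall c r := hs
    rw [Metric.mem_closedBall, dist_eq_norm] at hs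
    have := key y s
    refine abs_le_of_sq_le_sq' ?_ hr |>.2
    nlinarith [sq_nonneg (s - ⟪u, c⟫), norm_nonneg ((y:E) + s • u - c)]
  · intro h
    refine ⟨⟪u, c⟫, ?_⟩
    show (y:E) + ⟪u, c⟫ • u ∈ Metric.closedBall c r
    rw [Metric.mem_closedBall, dist_eq_norm]
    have := key y ⟪u, c⟫
    refine abs_le_of_sq_le_sq' ?_ hr |>.2
    rw [this]
    nlinarith [norm_nonneg (y - c')]

theorem volume_prj_ball {u : E} (hu : ‖u‖ = 1) (c : E) {r : ℝ} (hr : 0 ≤ r) :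
    volume (prj u (Metric.closedBall c r)) = ENNReal.ofReal (r ^ (Module.finrank ℝ E - 1)) *
      volume (Metric.closedBall (0 : EuclideanSpace ℝ (Fin (Module.finrank ℝ E - 1))) 1) := by
  obtain ⟨c', h⟩ := prj_ball hu c hr
  rw [h, volume_ball_eq (finrank_perp hu) c' hr]

theorem sweep_zero (K : Set E) : sweep K 0 = K := by
  ext z
  rw [mem_sweep]
  constructor
  · rintro ⟨k, hk, t, ht, rfl⟩; simpa using hk
  · intro h; exact ⟨z, h, 0, ⟨le_rfl, zero_le_one⟩, by simp⟩

theorem volume_sweep_ball (c x : E) {r : ℝ} (hr : 0 ≤ r) :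
    volume (sweep (Metric.closedBall c r) x) = volume (Metric.closedBall c r) +
      ENNReal.ofReal ‖x‖ * (ENNReal.ofReal (r ^ (Module.finrank ℝ E - 1)) *
      volume (Metric.closedBall (0 : EuclideanSpace ℝ (Fin (Module.finrank ℝ E - 1))) 1)) := by
  by_cases hx : x = 0
  · rw [hx, sweep_zero]; simp
  have hn : 0 < ‖x‖ := norm_pos_iff.2 hx
  have hu : ‖(‖x‖⁻¹ • x)‖ = 1 := by
    rw [norm_smul, norm_inv, norm_norm, inv_mul_cancel₀ hn.ne']
  have e : x = ‖x‖ • (‖x‖⁻¹ • x) := by rw [smul_smul, mul_inv_cancel₀ hn.ne', one_smul]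
  conv_lhs => rw [e]
  rw [volume_sweep hu (isCompact_closedBall _ _) (convex_closedBall _ _) hn.le, volume_prj_ball hu _ hr]

theorem Phi_ball {r₁ r₂ : ℝ} (h1 : 0 ≤ r₁) (h2 : 0 < r₂) :
    Phi (Metric.closedBall (0:E) r₁) (Metric.closedBall (0:E) r₂) =
      volume (Metric.closedBall (0:E) r₂) * (volume (Metric.closedBall (0:E) r₁) +
        ENNReal.ofReal (r₁ ^ (Module.finrank ℝ E - 1)) *
        volume (Metric.closedBall (0 : EuclideanSpace ℝ (Fin (Module.finrank ℝ E - 1))) 1) *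
        ENNReal.ofReal r₂ * kap (Module.finrank ℝ E)) := by
  set A := ENNReal.ofReal (r₁ ^ (Module.finrank ℝ E - 1)) *
        volume (Metric.closedBall (0 : EuclideanSpace ℝ (Fin (Module.finrank ℝ E - 1))) 1) with hA
  have : ∀ x : E, volume (sweep (Metric.closedBall (0:E) r₁) x) = volume (Metric.closedBall (0:E) r₁) +
      A * ENNReal.ofReal r₂ * ENNReal.ofReal (gauge (Metric.closedBall (0:E) r₂) x) := by
    intro x
    rw [volume_sweep_ball 0 x h1, gauge_closedBall h2.le, mul_assoc, ← ENNReal.ofReal_mul h2.le,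
      mul_div_cancel₀ _ h2.ne', mul_comm A]
  have hn : Metric.closedBall (0:E) r₂ ∈ nhds (0:E) := Metric.closedBall_mem_nhds _ h2
  have hc : Continuous (gauge (Metric.closedBall (0:E) r₂)) := continuous_gauge (convex_closedBall _ _) hn
  have hA' : A * ENNReal.ofReal r₂ ≠ ⊤ :=
    ENNReal.mul_ne_top (ENNReal.mul_ne_top (by simp) measure_closedBall_lt_top.ne) (by simp)
  rw [Phi]
  simp_rw [this]
  rw [lintegral_add_left measurable_const, lintegral_const_mul' _ _ hA',
    lint_gauge (isCompact_closedBall _ _) (convex_closedBall _ _) hn, setLIntegral_const]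
  ring

theorem diff_nhds {K : Set E} (h : (interior K).Nonempty) : K - K ∈ nhds (0:E) := by
  obtain ⟨x, hx⟩ := h
  have : (fun y => y + x) ⁻¹' (interior K) ∈ nhds (0:E) :=
    (isOpen_interior.preimage (by fun_prop)).mem_nhds (by simpa using hx)
  refine Filter.mem_of_superset this fun y hy => ?_
  exact ⟨y + x, interior_subset hy, x, interior_subset hx, by simp⟩

theorem gauge_pos' {L : Set E} (hL : IsCompact L) (h0 : L ∈ nhds (0:E)) {x : E} (hx : x ≠ 0) :
    0 < gauge L x :=
  (gauge_pos (absorbent_nhds_zero h0) (NormedSpace.isVonNBounded_of_isBounded ℝ hL.isBounded)).2 hx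

theorem inv_gauge_mem {L : Set E} (hL : IsCompact L) (hL' : Convex ℝ L) (h0 : L ∈ nhds (0:E))
    {x : E} (hx : x ≠ 0) : (gauge L x)⁻¹ • x ∈ L := by
  have h := gauge_pos' hL h0 hx
  have := (gauge_le_iff hL hL' h0 h x).1 le_rfl
  rwa [mem_smul_set_iff_inv_smul_mem₀ h.ne'] at this

theorem sweep_le {K : Set E} (hK : IsCompact K) (hK' : Convex ℝ K) (hi : (interior K).Nonempty)
    {N : ℝ≥0∞} (hN : ∀ u : E, ‖u‖ = 1 → ∀ z ∈ K - K,
      volume K + ENNReal.ofReal ⟪u, z⟫ * volume (prj u K) ≤ N) (x : E) :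
    volume (sweep K x) ≤ volume K + ENNReal.ofReal (gauge (K - K) x) * (N - volume K) := by
  by_cases hx : x = 0
  · rw [hx, sweep_zero]; simp
  have hn : 0 < ‖x‖ := norm_pos_iff.2 hx
  have hu : ‖(‖x‖⁻¹ • x)‖ = 1 := by
    rw [norm_smul, norm_inv, norm_norm, inv_mul_cancel₀ hn.ne']
  have e : x = ‖x‖ • (‖x‖⁻¹ • x) := by rw [smul_smul, mul_inv_cancel₀ hn.ne', one_smul]
  have h0 := diff_nhds hi
  have hg := gauge_pos' (compact_diff hK) h0 hx
  have h1 := hN _ hu _ (inv_gauge_mem (compact_diff hK) (hK'.sub hK') h0 hx)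
  conv_lhs => rw [e]
  rw [volume_sweep hu hK hK' hn.le]
  have h2 := ENNReal.le_sub_of_add_le_left hK.measure_lt_top.ne h1
  refine add_le_add le_rfl (le_trans (le_of_eq ?_) (mul_le_mul_right h2 _))
  rw [← mul_assoc, ← ENNReal.ofReal_mul hg.le]
  congr 2
  rw [inner_smul_left, inner_smul_right, real_inner_self_eq_norm_sq]
  simp only [conj_trivial]
  field_simp

theorem bound_int {K : Set E} (hK : IsCompact K) (hK' : Convex ℝ K) (hi : (interior K).Nonempty)
    {M : ℝ≥0∞} (hM : M ≠ ⊤) :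
    ∫⁻ x in K - K, (volume K + ENNReal.ofReal (gauge (K - K) x) * M) =
      volume (K - K) * (volume K + M * kap (Module.finrank ℝ E)) := by
  rw [lintegral_add_left measurable_const, lintegral_mul_const' _ _ hM,
    lint_gauge (compact_diff hK) (hK'.sub hK') (diff_nhds hi), setLIntegral_const]
  ring

theorem ball_diff [Nontrivial E] {r₁ r₂ : ℝ} (h1 : 0 ≤ r₁)
    (h : Metric.closedBall (0:E) r₁ - Metric.closedBall (0:E) r₁ ⊆ Metric.closedBall (0:E) r₂) :
    2 * r₁ ≤ r₂ := by
  obtain ⟨u, hu⟩ := exists_norm_eq E h1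
  have := h (sub_mem_sub (a := u) (b := -u) (by simp [hu]) (by simp [hu]))
  rw [mem_closedBall_zero_iff, sub_neg_eq_add, ← two_smul ℝ, norm_smul, hu] at this
  simpa using this

theorem main_ineq [Nontrivial E] {K : Set E} (hK : IsCompact K) (hK' : Convex ℝ K)
    (hi : (interior K).Nonempty)
    {N : ℝ≥0∞} (hNt : N ≠ ⊤) (hN : ∀ u : E, ‖u‖ = 1 → ∀ z ∈ K - K,
      volume K + ENNReal.ofReal ⟪u, z⟫ * volume (prj u K) ≤ N) {ω ν m : ℝ}
    (hω : ω = (volume (Metric.closedBall (0 : EuclideanSpace ℝ (Fin (Module.finrank ℝ E - 1))) 1)).toReal)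
    (hν : ν = (volume (Metric.closedBall (0 : EuclideanSpace ℝ (Fin (Module.finrank ℝ E))) 1)).toReal)
    (hm : m = (N - volume K).toReal) :
    2 * ω / ν * (volume K).toReal ≤ m ∧ (m ≤ 2 * ω / ν * (volume K).toReal →
      (∃ r : ℝ, 0 < r ∧ volume K = volume (Metric.closedBall (0:E) r) ∧
        volume (K - K) = volume (Metric.closedBall (0:E) (2 * r))) ∧
      ∫⁻ x in K - K, (volume K + ENNReal.ofReal (gauge (K - K) x) * (N - volume K)) ≤
        ∫⁻ x in K - K, volume (sweep K x)) := by
  have hMt : N - volume K ≠ ⊤ := ENNReal.sub_ne_top hNt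
  have hL := compact_diff hK
  have hL' := hK'.sub hK'
  have h0 := diff_nhds hi
  have hKv : 0 < volume K := (isOpen_interior.measure_pos volume hi).trans_le (measure_mono interior_subset)
  have hLv : 0 < volume (K - K) := MeasureTheory.Measure.measure_pos_of_mem_nhds _ h0
  have hd : Module.finrank ℝ E ≠ 0 := (Module.finrank_pos (R := ℝ) (M := E)).ne'
  set d := Module.finrank ℝ E with hdd
  obtain ⟨r₁, r₂, p1, p2, v1, v2, hs, hphi⟩ := sym_limit hK hK' hL hL' hKv hLv Subset.rfl
  have hrr := ball_diff p1 hs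
  have hνp : 0 < ν := by
    rw [hν]
    refine ENNReal.toReal_pos (Metric.measure_closedBall_pos _ _ one_pos).ne' measure_closedBall_lt_top.ne
  have hωp : 0 < ω := by
    rw [hω]
    refine ENNReal.toReal_pos (Metric.measure_closedBall_pos _ _ one_pos).ne' measure_closedBall_lt_top.ne
  have hb : ∀ r : ℝ, 0 ≤ r → volume (Metric.closedBall (0:E) r) = ENNReal.ofReal (r ^ d * ν) := by
    intro r hr
    rw [volume_ball_eq rfl _ hr, hν, ENNReal.ofReal_mul (by positivity),
      ENNReal.ofReal_toReal measure_closedBall_lt_top.ne]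
  have hr1 : 0 < r₁ := by
    refine p1.lt_of_ne ?_
    rintro rfl
    rw [hb 0 le_rfl] at v1
    simp [zero_pow hd] at v1
    exact hKv.ne' v1
  have hr2 : 0 < r₂ := by linarith
  have step : Phi K (K - K) ≤ volume (K - K) * (volume K + (N - volume K) * kap d) := by
    rw [← bound_int hK hK' hi hMt]
    exact lintegral_mono fun x => sweep_le hK hK' hi hN x
  have hkt : kap d ≠ ⊤ := kap_lt_top
  have hkp : 0 < (kap d).toReal := ENNReal.toReal_pos (kap_pos hd).ne' hkt
  set κ := (kap d).toReal with hκ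
  have hV : volume K = ENNReal.ofReal (volume K).toReal := (ENNReal.ofReal_toReal hK.measure_lt_top.ne).symm
  set V := (volume K).toReal with hVd
  have hV0 : 0 ≤ V := ENNReal.toReal_nonneg
  have hm0 : 0 ≤ m := hm ▸ ENNReal.toReal_nonneg
  have lhs : volume (Metric.closedBall (0:E) r₁) +
        ENNReal.ofReal (r₁ ^ (d - 1)) *
        volume (Metric.closedBall (0 : EuclideanSpace ℝ (Fin (d - 1))) 1) *
        ENNReal.ofReal r₂ * kap d = ENNReal.ofReal (r₁ ^ d * ν + r₁ ^ (d-1) * ω * r₂ * κ) := by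
    rw [hb _ p1, ENNReal.ofReal_add (by positivity) (by positivity), ENNReal.ofReal_mul (by positivity),
      ENNReal.ofReal_mul (by positivity), ENNReal.ofReal_mul (by positivity),
      ENNReal.ofReal_mul (by positivity), hκ, ENNReal.ofReal_toReal hkt, hω,
      ENNReal.ofReal_toReal measure_closedBall_lt_top.ne]
  have rhs : volume K + (N - volume K) * kap d = ENNReal.ofReal (V + m * κ) := by
    rw [ENNReal.ofReal_add hV0 (by positivity), ENNReal.ofReal_mul hm0, hκ, ENNReal.ofReal_toReal hkt, hm,
      ENNReal.ofReal_toReal hMt, ← hV]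
  have hP := Phi_ball (E := E) p1 hr2
  rw [← hdd, lhs, ← v2] at hP
  rw [hP] at hphi
  have c1 := hphi.trans step
  rw [rhs, ENNReal.mul_le_mul_iff_right hLv.ne' hL.measure_lt_top.ne,
    ENNReal.ofReal_le_ofReal_iff (by positivity)] at c1
  have c2 : V ≤ r₁ ^ d * ν := by
    rw [hb _ p1, hV, ENNReal.ofReal_le_ofReal_iff (by positivity)] at v1
    exact v1
  have hpow : r₁ ^ d = r₁ ^ (d-1) * r₁ := by rw [← pow_succ]; congr 1; omega
  have hp1 : 0 < r₁ ^ (d-1) := by positivity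
  have c3 : 2 * (r₁ ^ d * ω * κ) ≤ r₁ ^ (d-1) * ω * r₂ * κ := by
    have : 0 ≤ r₁ ^ (d-1) * ω * κ * (r₂ - 2 * r₁) := mul_nonneg (by positivity) (by linarith)
    rw [hpow]; nlinarith
  have c4 : 2 * r₁ ^ d * ω ≤ m := by
    have : 2 * r₁ ^ d * ω * κ ≤ m * κ := by linarith
    exact le_of_mul_le_mul_right this hkp
  have c5 : 2 * ω / ν * V ≤ 2 * r₁ ^ d * ω := by
    rw [div_mul_eq_mul_div, div_le_iff₀ hνp]
    nlinarith
  refine ⟨c5.trans c4, fun hle => ?_⟩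
  have c6 : 2 * r₁ ^ d * ω ≤ 2 * ω / ν * V := c4.trans hle
  have c7 : r₁ ^ d * ν = V := by
    rw [div_mul_eq_mul_div, le_div_iff₀ hνp] at c6
    refine le_antisymm ?_ c2
    have : r₁ ^ d * ν * ω ≤ V * ω := by linarith
    exact le_of_mul_le_mul_right this hωp
  have c8 : m = 2 * r₁ ^ d * ω := le_antisymm (hle.trans c5) c4
  have c9 : r₂ = 2 * r₁ := by
    refine le_antisymm ?_ hrr
    have h1 : r₁ ^ (d-1) * ω * r₂ * κ ≤ m * κ := by linarith
    rw [c8, hpow] at h1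
    have h2 : (r₁ ^ (d-1) * ω * κ) * r₂ ≤ (r₁ ^ (d-1) * ω * κ) * (2 * r₁) := by linarith
    exact le_of_mul_le_mul_left h2 (by positivity)
  refine ⟨⟨r₁, hr1, ?_, ?_⟩, ?_⟩
  · rw [hb _ p1, c7, ← hV]
  · rw [v2, c9]
  · rw [bound_int hK hK' hi hMt, ← hdd, rhs]
    refine le_trans (le_of_eq ?_) hphi
    congr 2
    rw [c7, c9, c8, hpow]; ring

end Main

section Eqc
set_option linter.unusedSectionVars false
variable {E : Type*} [NormedAddCommGroup E] [InnerProductSpace ℝ E] [FiniteDimensional ℝ E]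
  [MeasurableSpace E] [BorelSpace E]

theorem gauge_ineq_of {K : Set E} (hK : IsCompact K) (hK' : Convex ℝ K) (hi : (interior K).Nonempty)
    {N : ℝ≥0∞} (hNt : N ≠ ⊤) (hN : ∀ u : E, ‖u‖ = 1 → ∀ z ∈ K - K,
      volume K + ENNReal.ofReal ⟪u, z⟫ * volume (prj u K) ≤ N) (hM : N - volume K ≠ 0) {x : E}
    (hx : x ≠ 0) (h : volume (sweep K x) = volume K + ENNReal.ofReal (gauge (K - K) x) * (N - volume K))
    {z : E} (hz : z ∈ K - K) : gauge (K - K) x * ⟪x, z⟫ ≤ ‖x‖ ^ 2 := by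
  have hMt : N - volume K ≠ ⊤ := ENNReal.sub_ne_top hNt
  have hn : 0 < ‖x‖ := norm_pos_iff.2 hx
  have hu : ‖(‖x‖⁻¹ • x)‖ = 1 := by
    rw [norm_smul, norm_inv, norm_norm, inv_mul_cancel₀ hn.ne']
  have e : x = ‖x‖ • (‖x‖⁻¹ • x) := by rw [smul_smul, mul_inv_cancel₀ hn.ne', one_smul]
  have h0 := diff_nhds hi
  have hg := gauge_pos' (compact_diff hK) h0 hx
  have h1 := hN _ hu _ hz
  have h2 := ENNReal.le_sub_of_add_le_left hK.measure_lt_top.ne h1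
  have h3 : volume (sweep K x) = volume K + ENNReal.ofReal ‖x‖ * volume (prj (‖x‖⁻¹ • x) K) := by
    conv_lhs => rw [e]
    exact volume_sweep hu hK hK' hn.le
  rw [h3] at h
  rw [ENNReal.add_right_inj hK.measure_lt_top.ne] at h
  have h4 := congrArg ENNReal.toReal h
  have hA : volume (prj (‖x‖⁻¹ • x) K) ≠ ⊤ := by
    intro hA
    rw [hA, ENNReal.mul_top (by simpa using hx)] at h
    exact ENNReal.mul_ne_top ENNReal.ofReal_ne_top hMt h.symm
  rw [ENNReal.toReal_mul, ENNReal.toReal_mul, ENNReal.toReal_ofReal hn.le, ENNReal.toReal_ofReal hg.le] at h4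
  have h5 := ENNReal.toReal_mono hMt h2
  rw [ENNReal.toReal_mul] at h5
  have hm : 0 < (N - volume K).toReal := ENNReal.toReal_pos hM hMt
  set a := (volume (prj (‖x‖⁻¹ • x) K)).toReal
  set m := (N - volume K).toReal
  have ha : 0 < a := by
    have : 0 < ‖x‖ * a := by rw [h4]; positivity
    exact pos_of_mul_pos_right this hn.le
  have h6 : ⟪‖x‖⁻¹ • x, z⟫ * a ≤ m :=
    (mul_le_mul_of_nonneg_right (ENNReal.toReal_ofReal' ▸ le_max_left _ _) ha.le).trans h5
  rw [inner_smul_left] at h6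
  simp only [conj_trivial] at h6
  have h7 : ⟪x, z⟫ * a ≤ ‖x‖ * m := by
    have := mul_le_mul_of_nonneg_left h6 hn.le
    have e2 : ‖x‖ * (‖x‖⁻¹ * ⟪x, z⟫ * a) = ⟪x, z⟫ * a := by field_simp
    linarith
  have h8 : (gauge (K - K) x * ⟪x, z⟫) * a ≤ ‖x‖ ^ 2 * a := by
    have := mul_le_mul_of_nonneg_left h7 hg.le
    nlinarith
  exact le_of_mul_le_mul_right h8 ha

theorem gauge_ineq {K : Set E} (hK : IsCompact K) (hK' : Convex ℝ K) (hi : (interior K).Nonempty)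
    {N : ℝ≥0∞} (hNt : N ≠ ⊤) (hN : ∀ u : E, ‖u‖ = 1 → ∀ z ∈ K - K,
      volume K + ENNReal.ofReal ⟪u, z⟫ * volume (prj u K) ≤ N) (hM : N - volume K ≠ 0)
    (heq : ∫⁻ x in K - K, (volume K + ENNReal.ofReal (gauge (K - K) x) * (N - volume K)) ≤
        ∫⁻ x in K - K, volume (sweep K x)) (x : E) {z : E} (hz : z ∈ K - K) :
    gauge (K - K) x * ⟪x, z⟫ ≤ ‖x‖ ^ 2 := by
  have hMt : N - volume K ≠ ⊤ := ENNReal.sub_ne_top hNt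
  have hL := compact_diff hK
  have hL' := hK'.sub hK'
  have h0 := diff_nhds hi
  have hc := continuous_gauge hL' h0
  have hle : ∀ x, volume (sweep K x) ≤ volume K + ENNReal.ofReal (gauge (K - K) x) * (N - volume K) :=
    fun x => sweep_le hK hK' hi hN x
  have hfin : ∫⁻ x in K - K, volume (sweep K x) ≠ ⊤ := by
    refine ne_top_of_le_ne_top ?_ (lintegral_mono hle)
    rw [bound_int hK hK' hi hMt]
    exact ENNReal.mul_ne_top hL.measure_lt_top.ne (ENNReal.add_ne_top.2
      ⟨hK.measure_lt_top.ne, ENNReal.mul_ne_top hMt kap_lt_top⟩)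
  have hae := ae_eq_of_ae_le_of_lintegral_le (μ := volume.restrict (K - K))
    (Filter.Eventually.of_forall hle) hfin (by fun_prop) heq
  set G : Set E := {x | gauge (K - K) x * ⟪x, z⟫ ≤ ‖x‖ ^ 2} with hG
  have hGc : IsClosed G := isClosed_le (by fun_prop) (by fun_prop)
  have hGae : ∀ᵐ x ∂(volume.restrict (K - K)), x ∈ G := by
    filter_upwards [hae] with x hx
    by_cases hx0 : x = 0
    · subst hx0; change gauge (K - K) (0:E) * ⟪(0:E), z⟫ ≤ ‖(0:E)‖ ^ 2; simp
    · exact gauge_ineq_of hK hK' hi hNt hN hM hx0 hx hz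
  have hsub : interior (K - K) ⊆ G := by
    by_contra hcon
    obtain ⟨y, hy, hyG⟩ := not_subset.1 hcon
    have hop : IsOpen (interior (K - K) ∩ Gᶜ) := isOpen_interior.inter hGc.isOpen_compl
    have hpos := hop.measure_pos volume ⟨y, hy, hyG⟩
    have h1 : volume.restrict (K - K) Gᶜ = 0 := hGae
    rw [Measure.restrict_apply hGc.isOpen_compl.measurableSet] at h1
    have h2 : volume (interior (K - K) ∩ Gᶜ) ≤ volume (Gᶜ ∩ (K - K)) :=
      measure_mono fun w hw => ⟨hw.2, interior_subset hw.1⟩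
    rw [h1] at h2
    exact absurd hpos (by simpa using h2)
  have ht : Filter.Tendsto (fun t : ℝ => t • x) (nhdsWithin 0 (Ioi 0)) (nhds (0:E)) := by
    have : Filter.Tendsto (fun t : ℝ => t • x) (nhds 0) (nhds ((0:ℝ) • x)) :=
      (continuous_id.smul continuous_const).tendsto 0
    rw [zero_smul] at this
    exact this.mono_left nhdsWithin_le_nhds
  obtain ⟨t, h1, h2⟩ := ((ht.eventually_mem (interior_mem_nhds.2 h0)).and self_mem_nhdsWithin).exists
  have h2 : 0 < t := h2
  have h3 : gauge (K - K) (t • x) * ⟪t • x, z⟫ ≤ ‖t • x‖ ^ 2 := hsub h1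
  rw [gauge_smul_of_nonneg h2.le, inner_smul_left, norm_smul, mul_pow, Real.norm_eq_abs, sq_abs] at h3
  simp only [conj_trivial, smul_eq_mul] at h3
  have h4 : t ^ 2 * (gauge (K - K) x * ⟪x, z⟫) ≤ t ^ 2 * ‖x‖ ^ 2 := by linarith
  exact le_of_mul_le_mul_left h4 (by positivity)

theorem const_of_cos {f : E → ℝ} (hp : ∀ x, ‖x‖ = 1 → 0 < f x) (hev : ∀ x, f (-x) = f x)
    (h : ∀ x y, ‖x‖ = 1 → ‖y‖ = 1 → f x * ⟪x, y⟫ ≤ f y) :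
    ∀ x y, ‖x‖ = 1 → ‖y‖ = 1 → f x ≤ f y := by
  have step : ∀ n : ℕ, ∀ x y, ‖x‖ = 1 → ‖y‖ = 1 → 0 ≤ ⟪x, y⟫ →
      f x * (1 - (2/3:ℝ) ^ n * (1 - ⟪x, y⟫)) ≤ f y := by
    intro n
    induction n with
    | zero =>
      intro x y hx hy _
      have := h x y hx hy
      simpa using this
    | succ n ih =>
      intro x y hx hy hc
      set c := ⟪x, y⟫ with hcd
      set s := ‖x + y‖ with hs
      have hs2 : s ^ 2 = 2 + 2 * c := by
        rw [hs, norm_add_sq_real, hx, hy]; ring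
      have hs0 : 0 ≤ s := norm_nonneg _
      have hsp : 0 < s := by
        rcases hs0.eq_or_lt with h | h
        · rw [← h] at hs2; nlinarith
        · exact h
      have hs1 : 1 ≤ s := by nlinarith
      have hc1 : c ≤ 1 := by
        have := real_inner_le_norm x y
        rw [hx, hy] at this; linarith
      have hsle : s ≤ 2 := by nlinarith
      set m := s⁻¹ • (x + y) with hm
      have hmn : ‖m‖ = 1 := by
        rw [hm, norm_smul, norm_inv, norm_norm, inv_mul_cancel₀ hsp.ne']
      have i1 : ⟪x, m⟫ = s / 2 := by
        rw [hm, inner_smul_right, inner_add_right, real_inner_self_eq_norm_sq, hx, ← hcd]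
        field_simp; linarith
      have i2 : ⟪m, y⟫ = s / 2 := by
        rw [hm, inner_smul_left, inner_add_left, real_inner_self_eq_norm_sq, hy, ← hcd]
        simp only [conj_trivial]
        field_simp; linarith
      have e1 := ih x m hx hmn (by rw [i1]; positivity)
      have e2 := ih m y hmn hy (by rw [i2]; positivity)
      rw [i1] at e1
      rw [i2] at e2
      have ha : (2/3:ℝ) ^ n ≤ 1 := pow_le_one₀ (by norm_num) (by norm_num)
      have ha0 : 0 < (2/3:ℝ) ^ n := by positivity
      rw [pow_succ]
      set a := (2/3:ℝ) ^ n
      have hq0 : 0 ≤ 1 - a * (1 - s / 2) := by nlinarith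
      have e3 := (mul_le_mul_of_nonneg_right e1 hq0).trans e2
      refine le_trans ?_ e3
      rw [mul_assoc (f x) (1 - a * (1 - s / 2))]
      refine mul_le_mul_of_nonneg_left ?_ (hp x hx).le
      have k1 : 2 * (1 - s / 2) ≤ 2 / 3 * (1 - c) := by nlinarith
      have k2 := mul_le_mul_of_nonneg_left k1 ha0.le
      nlinarith [sq_nonneg (a * (1 - s / 2))]
  have pos : ∀ x y, ‖x‖ = 1 → ‖y‖ = 1 → 0 ≤ ⟪x, y⟫ → f x ≤ f y := by
    intro x y hx hy hc
    have ht : Filter.Tendsto (fun n : ℕ => f x * (1 - (2/3:ℝ) ^ n * (1 - ⟪x, y⟫))) Filter.atTop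
        (nhds (f x * (1 - 0 * (1 - ⟪x, y⟫)))) :=
      ((((tendsto_pow_atTop_nhds_zero_of_lt_one (by norm_num) (by norm_num)).mul_const _).const_sub _).const_mul _)
    have := le_of_tendsto' ht fun n => step n x y hx hy hc
    simpa using this
  intro x y hx hy
  rcases le_total 0 ⟪x, y⟫ with hc | hc
  · exact pos x y hx hy hc
  · rw [← hev x]
    exact pos (-x) y (by simpa using hx) hy (by rw [inner_neg_left]; linarith)

theorem diff_is_ball {L : Set E} [Nontrivial E] (hL : IsCompact L) (hL' : Convex ℝ L) (h0 : L ∈ nhds (0:E))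
    (hs : ∀ x ∈ L, -x ∈ L) (h : ∀ x z, z ∈ L → gauge L x * ⟪x, z⟫ ≤ ‖x‖ ^ 2) :
    ∃ ρ : ℝ, 0 < ρ ∧ L = Metric.closedBall 0 ρ := by
  have hne : ∀ x : E, ‖x‖ = 1 → x ≠ 0 := by rintro x hx rfl; simp at hx
  have hpos : ∀ x : E, ‖x‖ = 1 → 0 < gauge L x := fun x hx => gauge_pos' hL h0 (hne x hx)
  have hev : ∀ x, gauge L (-x) = gauge L x := gauge_neg hs
  have hle := const_of_cos hpos hev (by
    intro x y hx hy
    have h1 := h x _ (inv_gauge_mem hL hL' h0 (hne y hy))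
    rw [inner_smul_right, hx] at h1
    have := hpos y hy
    have e : gauge L y * (gauge L x * ((gauge L y)⁻¹ * ⟪x, y⟫)) = gauge L x * ⟪x, y⟫ := by field_simp
    have := mul_le_mul_of_nonneg_left h1 this.le
    rw [e] at this
    linarith)
  obtain ⟨u, hu⟩ := exists_norm_eq E (zero_le_one (α := ℝ))
  set k := gauge L u
  have hk : 0 < k := hpos u hu
  have hg : ∀ x, gauge L x = k * ‖x‖ := by
    intro x
    by_cases hx : x = 0
    · simp [hx]
    have hn : 0 < ‖x‖ := norm_pos_iff.2 hx
    have hv : ‖(‖x‖⁻¹ • x)‖ = 1 := by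
      rw [norm_smul, norm_inv, norm_norm, inv_mul_cancel₀ hn.ne']
    have e : gauge L (‖x‖⁻¹ • x) = k := le_antisymm (hle _ _ hv hu) (hle _ _ hu hv)
    rw [gauge_smul_of_nonneg (by positivity), smul_eq_mul] at e
    rw [← e]; field_simp
  refine ⟨k⁻¹, by positivity, ?_⟩
  ext x
  have h1 := gauge_le_iff hL hL' h0 one_pos x
  rw [one_smul] at h1
  rw [← h1, hg, mem_closedBall_zero_iff, ← one_div, le_div_iff₀' hk]

theorem ball_radius_eq [Nontrivial E] {r s : ℝ} (hr : 0 ≤ r) (hs : 0 ≤ s)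
    (h : volume (Metric.closedBall (0:E) r) = volume (Metric.closedBall (0:E) s)) : r = s := by
  rw [volume_ball_eq rfl _ hr, volume_ball_eq rfl _ hs, ENNReal.mul_left_inj
    (Metric.measure_closedBall_pos _ _ one_pos).ne' measure_closedBall_lt_top.ne,
    ENNReal.ofReal_eq_ofReal_iff (by positivity) (by positivity)] at h
  exact (pow_left_inj₀ hr hs (Module.finrank_pos (R := ℝ) (M := E)).ne').1 h

end Eqc

section Eqd
set_option linter.unusedSectionVars false
variable {E : Type*} [NormedAddCommGroup E] [InnerProductSpace ℝ E] [FiniteDimensional ℝ E]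
  [MeasurableSpace E] [BorelSpace E]

theorem diff_ge [Nontrivial E] {C : Set E} (hC : IsCompact C) (hC' : Convex ℝ C) {r : ℝ} (hr : 0 < r)
    (h : volume (Metric.closedBall (0:E) r) ≤ volume C) :
    volume (Metric.closedBall (0:E) (2 * r)) ≤ volume (C - C) := by
  have hv : 0 < volume C := (Metric.measure_closedBall_pos _ _ hr).trans_le h
  have hi := interior_nonempty_of_volume hC' hv
  have hLv : 0 < volume (C - C) := Measure.measure_pos_of_mem_nhds _ (diff_nhds hi)
  obtain ⟨r₁, r₂, p1, p2, v1, v2, hs, -⟩ :=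
    sym_limit hC hC' (compact_diff hC) (hC'.sub hC') hv hLv Subset.rfl
  have hrr := ball_diff p1 hs
  rw [v2]
  refine measure_mono (Metric.closedBall_subset_closedBall ?_)
  have h1 := h.trans v1
  rw [volume_ball_eq rfl _ hr.le, volume_ball_eq rfl _ p1, ENNReal.mul_le_mul_iff_left
    (Metric.measure_closedBall_pos _ _ one_pos).ne' measure_closedBall_lt_top.ne,
    ENNReal.ofReal_le_ofReal_iff (by positivity)] at h1
  have := (pow_le_pow_iff_left₀ hr.le p1 (Module.finrank_pos (R := ℝ) (M := E)).ne').1 h1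
  linarith

theorem fsum_diff_eq [Nontrivial E] {K : Set E} (hK : IsCompact K) (hK' : Convex ℝ K) {r : ℝ} (hr : 0 < r)
    (hv : volume K = volume (Metric.closedBall (0:E) r)) (hd : K - K = Metric.closedBall (0:E) (2 * r))
    {e : E} (he : ‖e‖ = 1) :
    Metric.closedBall (0:E) (2 * r) ⊆ fsum e K K - fsum e K K := by
  have hS := fsum_compact e hK hK
  have hS' := fsum_convex e hK' hK'
  have hvS := volume_fsum_self he hK hK'
  have h1 := diff_ge hS hS' hr (by rw [hvS, hv])
  have h2 : fsum e K K - fsum e K K ⊆ Metric.closedBall (0:E) (2 * r) :=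
    (fsum_sub e K (K - K) Subset.rfl).trans (fsum_ball he hd.le)
  have hc := compact_diff hS
  set D := fsum e K K - fsum e K K
  have h3 : volume (Metric.closedBall (0:E) (2 * r) \ D) = 0 := by
    rw [measure_sdiff h2 hc.measurableSet.nullMeasurableSet hc.measure_lt_top.ne]
    exact tsub_eq_zero_of_le h1
  have h4 : Metric.ball (0:E) (2 * r) ⊆ D := by
    by_contra hcon
    obtain ⟨y, hy, hyD⟩ := not_subset.1 hcon
    have hop : IsOpen (Metric.ball (0:E) (2 * r) ∩ Dᶜ) := Metric.isOpen_ball.inter hc.isClosed.isOpen_compl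
    have hpos := hop.measure_pos volume ⟨y, hy, hyD⟩
    have : volume (Metric.ball (0:E) (2 * r) ∩ Dᶜ) ≤ 0 := by
      rw [← h3]
      exact measure_mono fun w hw => ⟨Metric.ball_subset_closedBall hw.1, hw.2⟩
    exact absurd hpos (by simpa using this)
  rw [← closure_ball (0:E) (by positivity : (2 * r) ≠ 0)]
  exact closure_minimal h4 hc.isClosed

theorem eq_of_sum {u p q : E} (hu : ‖u‖ = 1) {s : ℝ} (hp : ‖p‖ ≤ s) (hq : ‖q‖ ≤ s)
    (h : p + q = (2 * s) • u) : p = s • u := by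
  have i1 : ⟪u, p⟫ ≤ s := (real_inner_le_norm u p).trans (by rw [hu]; linarith)
  have i2 : ⟪u, q⟫ ≤ s := (real_inner_le_norm u q).trans (by rw [hu]; linarith)
  have i3 : ⟪u, p⟫ + ⟪u, q⟫ = 2 * s := by
    rw [← inner_add_right, h, inner_smul_right, real_inner_self_eq_norm_sq, hu]; ring
  have hs : 0 ≤ s := (norm_nonneg p).trans hp
  have h4 : ‖p - s • u‖ ^ 2 ≤ 0 := by
    rw [norm_sub_sq_real, inner_smul_right, real_inner_comm, norm_smul, hu, Real.norm_eq_abs, mul_one,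
      sq_abs]
    have : ⟪u, p⟫ = s := by linarith
    rw [this]
    nlinarith [norm_nonneg p]
  have h5 : ‖p - s • u‖ = 0 := by
    have := norm_nonneg (p - s • u)
    nlinarith
  exact sub_eq_zero.1 (norm_eq_zero.1 h5)

theorem pair_points [Nontrivial E] {K : Set E} (hK : IsCompact K) (hK' : Convex ℝ K) {r : ℝ} (hr : 0 < r)
    (hv : volume K = volume (Metric.closedBall (0:E) r)) (hd : K - K = Metric.closedBall (0:E) (2 * r))
    {u v : E} (hu : ‖u‖ = 1) (hv1 : ‖v‖ = 1) (huv : u ≠ v) :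
    ∃ a ∈ K, ∃ a' ∈ K, ∃ b ∈ K, ∃ b' ∈ K, a - a' = (2 * r) • u ∧ b - b' = (2 * r) • v ∧
      ∃ t : ℝ, a - b = t • (u - v) := by
  have hn : 0 < ‖u - v‖ := norm_pos_iff.2 (sub_ne_zero.2 huv)
  set s := ‖u - v‖ with hs
  set e := s⁻¹ • (u - v) with he
  have he1 : ‖e‖ = 1 := by rw [he, norm_smul, norm_inv, norm_norm, inv_mul_cancel₀ hn.ne']
  have hs2 : s ^ 2 = 2 - 2 * ⟪u, v⟫ := by rw [hs, norm_sub_sq_real, hu, hv1]; ring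
  have hrv : rfL e v = u := by
    rw [rfL_apply, he, inner_smul_left, inner_sub_left, real_inner_self_eq_norm_sq, hv1, smul_smul]
    simp only [conj_trivial]
    have : 2 * (s⁻¹ * (⟪u, v⟫ - 1 ^ 2)) * s⁻¹ = -1 := by field_simp; linarith
    rw [this]; module
  have hru : rfL e u = v := by rw [← hrv, rfL_rfL he1]
  have hmem : (2 * r) • u ∈ Metric.closedBall (0:E) (2 * r) := by
    rw [mem_closedBall_zero_iff, norm_smul, hu, Real.norm_eq_abs, abs_of_pos (by positivity), mul_one]
  obtain ⟨x, hx, y, hy, hxy⟩ := fsum_diff_eq hK hK' hr hv hd he1 hmem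
  rw [mem_fsum] at hx hy
  obtain ⟨a, ha, b, hb, hab, rfl⟩ := hx
  obtain ⟨a', ha', b', hb', hab', rfl⟩ := hy
  have n1 : ‖a - a'‖ ≤ 2 * r := by
    rw [← mem_closedBall_zero_iff, ← hd]; exact sub_mem_sub ha ha'
  have n2 : ‖rfL e (b - b')‖ ≤ 2 * r := by
    rw [rfL_norm he1, ← mem_closedBall_zero_iff, ← hd]; exact sub_mem_sub hb hb'
  have hsum : (a - a') + rfL e (b - b') = (2 * (2 * r)) • u := by
    rw [mul_smul, ← hxy, map_sub]
    module
  have e1 := eq_of_sum hu n1 n2 hsum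
  have e2 := eq_of_sum hu n2 n1 (by rw [add_comm]; exact hsum)
  refine ⟨a, ha, a', ha', b, hb, b', hb', e1, ?_, (⟪e, a⟫ - ⟪e, b⟫) * s⁻¹, ?_⟩
  · rw [← rfL_rfL he1 (b - b'), e2, map_smul, hru]
  · rw [mul_smul, ← he]
    rw [perpL_apply, perpL_apply] at hab
    rw [sub_smul]
    have h9 : a = b - ⟪e, b⟫ • e + ⟪e, a⟫ • e := by rw [← hab]; abel
    rw [sub_eq_iff_eq_add]
    nth_rewrite 1 [h9]
    abel

theorem unique_point {K : Set E} {r : ℝ} (hd : K - K = Metric.closedBall (0:E) (2 * r))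
    {u a a' b b' : E} (hu : ‖u‖ = 1) (ha : a ∈ K) (ha' : a' ∈ K) (hb : b ∈ K) (hb' : b' ∈ K)
    (h1 : a - a' = (2 * r) • u) (h2 : b - b' = (2 * r) • u) : a = b := by
  have n1 : ‖a - b'‖ ≤ 2 * r := by
    rw [← mem_closedBall_zero_iff, ← hd]; exact sub_mem_sub ha hb'
  have n2 : ‖b - a'‖ ≤ 2 * r := by
    rw [← mem_closedBall_zero_iff, ← hd]; exact sub_mem_sub hb ha'
  have := eq_of_sum hu n1 n2 (by
    have : (2 * (2 * r)) • u = (a - a') + (b - b') := by rw [h1, h2]; module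
    rw [this]; abel)
  rw [← h2] at this
  exact sub_left_injective this

theorem ball_of_diff [Nontrivial E] {K : Set E} (hK : IsCompact K) (hK' : Convex ℝ K) {r : ℝ} (hr : 0 < r)
    (hv : volume K = volume (Metric.closedBall (0:E) r)) (hd : K - K = Metric.closedBall (0:E) (2 * r)) :
    ∃ c, K = Metric.closedBall c r := by
  have hex : ∀ u : E, ‖u‖ = 1 → ∃ a ∈ K, ∃ a' ∈ K, a - a' = (2 * r) • u := by
    intro u hu
    have : (2 * r) • u ∈ K - K := by
      rw [hd, mem_closedBall_zero_iff, norm_smul, hu, Real.norm_eq_abs, abs_of_pos (by positivity), mul_one]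
    obtain ⟨a, ha, a', ha', h⟩ := this
    exact ⟨a, ha, a', ha', h⟩
  have hex2 : ∀ u : E, ∃ q : E, ‖u‖ = 1 → (q + r • u ∈ K ∧ q - r • u ∈ K) := by
    intro u
    by_cases hu : ‖u‖ = 1
    · obtain ⟨a, ha, a', ha', h⟩ := hex u hu
      refine ⟨a - r • u, fun _ => ⟨by simpa using ha, ?_⟩⟩
      have : a - r • u - r • u = a' := by
        have : a = a' + (2 * r) • u := by rw [← h]; abel
        rw [this]; module
      rwa [this]
    · exact ⟨0, fun h => absurd h hu⟩
  choose q hq using hex2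
  have huniq : ∀ u : E, ‖u‖ = 1 → ∀ a ∈ K, ∀ a' ∈ K, a - a' = (2 * r) • u → a = q u + r • u := by
    intro u hu a ha a' ha' h
    exact unique_point hd hu ha ha' (hq u hu).1 (hq u hu).2 h (by module)
  have hneg : ∀ u : E, ‖u‖ = 1 → q (-u) = q u := by
    intro u hu
    have := huniq (-u) (by simpa using hu) _ (hq u hu).2 _ (hq u hu).1 (by module)
    have h2 : q (-u) = q u - r • u - r • (-u) := by rw [this]; abel
    rw [h2]; module
  have hpar : ∀ u v : E, ‖u‖ = 1 → ‖v‖ = 1 → u ≠ v → ∃ t : ℝ, q u - q v = t • (u - v) := by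
    intro u v hu hv1 huv
    obtain ⟨a, ha, a', ha', b, hb, b', hb', h1, h2, t, ht⟩ := pair_points hK hK' hr hv hd hu hv1 huv
    rw [huniq u hu a ha a' ha' h1, huniq v hv1 b hb b' hb' h2] at ht
    refine ⟨t - r, ?_⟩
    rw [sub_smul, ← ht]; module
  have hconst : ∀ u v : E, ‖u‖ = 1 → ‖v‖ = 1 → q u = q v := by
    intro u v hu hv1
    by_cases h1 : u = v
    · rw [h1]
    by_cases h2 : u = -v
    · rw [h2, hneg v hv1]
    obtain ⟨t, ht⟩ := hpar u v hu hv1 h1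
    obtain ⟨s, hs⟩ := hpar u (-v) hu (by simpa using hv1) h2
    rw [hneg v hv1] at hs
    have : ⟪q u - q v, q u - q v⟫ = 0 := by
      nth_rewrite 1 [hs]
      rw [ht, inner_smul_left, inner_smul_right, sub_neg_eq_add, inner_add_left, inner_sub_right, inner_sub_right,
        real_inner_self_eq_norm_sq, real_inner_self_eq_norm_sq, hu, hv1, real_inner_comm v u]
      ring
    exact sub_eq_zero.1 (inner_self_eq_zero.1 this)
  obtain ⟨w, hw⟩ := exists_norm_eq E (zero_le_one (α := ℝ))
  refine ⟨q w, ?_⟩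
  set c := q w
  have hin : ∀ u : E, ‖u‖ = 1 → c + r • u ∈ K ∧ c - r • u ∈ K := by
    intro u hu
    have h7 : c = q u := hconst w u hw hu
    rw [h7]; exact hq u hu
  have hcK : c ∈ K := by
    have := hK' (hin w hw).1 (hin w hw).2 (a := 1/2) (b := 1/2) (by norm_num) (by norm_num) (by norm_num)
    convert this using 1
    module
  ext x
  rw [mem_closedBall_iff_norm]
  by_cases hx : x = c
  · rw [hx]; simp [hcK, hr.le]
  have hn : 0 < ‖x - c‖ := norm_pos_iff.2 (sub_ne_zero.2 hx)
  set s := ‖x - c‖ with hs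
  set e := s⁻¹ • (x - c) with he
  have he1 : ‖e‖ = 1 := by rw [he, norm_smul, norm_inv, norm_norm, inv_mul_cancel₀ hn.ne']
  have hxe : x = c + s • e := by rw [he, smul_smul, mul_inv_cancel₀ hn.ne']; module
  constructor
  · intro hxK
    have h1 : x - (c - r • e) ∈ K - K := sub_mem_sub hxK (hin e he1).2
    rw [hd, mem_closedBall_zero_iff] at h1
    have h2 : x - (c - r • e) = (s + r) • e := by rw [hxe]; module
    rw [h2, norm_smul, he1, Real.norm_eq_abs, abs_of_pos (by positivity)] at h1
    linarith
  · intro hsr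
    have := hK' (hin e he1).1 hcK (a := s / r) (b := 1 - s / r) (by positivity)
      (sub_nonneg.2 ((div_le_one hr).2 hsr)) (by ring)
    convert this using 1
    have h3 : s • e = (s / r) • (r • e) := by rw [smul_smul (s / r), div_mul_cancel₀ _ hr.ne']
    conv_lhs => rw [hxe, h3]
    module

theorem main_eq [Nontrivial E] {K : Set E} (hK : IsCompact K) (hK' : Convex ℝ K)
    (hi : (interior K).Nonempty)
    {N : ℝ≥0∞} (hNt : N ≠ ⊤) (hN : ∀ u : E, ‖u‖ = 1 → ∀ z ∈ K - K,
      volume K + ENNReal.ofReal ⟪u, z⟫ * volume (prj u K) ≤ N) {ω ν m : ℝ}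
    (hω : ω = (volume (Metric.closedBall (0 : EuclideanSpace ℝ (Fin (Module.finrank ℝ E - 1))) 1)).toReal)
    (hν : ν = (volume (Metric.closedBall (0 : EuclideanSpace ℝ (Fin (Module.finrank ℝ E))) 1)).toReal)
    (hm : m = (N - volume K).toReal) (hle : m ≤ 2 * ω / ν * (volume K).toReal) :
    ∃ (c : E) (r : ℝ), 0 < r ∧ K = Metric.closedBall c r := by
  have hMI := main_ineq hK hK' hi hNt hN hω hν hm
  obtain ⟨⟨r, hr, hv, hvd⟩, hintegral⟩ := hMI.2 hle
  have hmp : 0 < m := by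
    refine lt_of_lt_of_le ?_ hMI.1
    have h1 : 0 < ν := by
      rw [hν]
      refine ENNReal.toReal_pos (Metric.measure_closedBall_pos _ _ one_pos).ne' measure_closedBall_lt_top.ne
    have h2 : 0 < ω := by
      rw [hω]
      refine ENNReal.toReal_pos (Metric.measure_closedBall_pos _ _ one_pos).ne' measure_closedBall_lt_top.ne
    have h3 : 0 < (volume K).toReal := by
      rw [hv]
      refine ENNReal.toReal_pos (Metric.measure_closedBall_pos _ _ hr).ne' measure_closedBall_lt_top.ne
    positivity
  have hM : N - volume K ≠ 0 := by
    intro h0; rw [hm, h0] at hmp; simp at hmp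
  obtain ⟨ρ, hρ, hL⟩ := diff_is_ball (compact_diff hK) (hK'.sub hK') (diff_nhds hi)
    (by rintro _ ⟨a, ha, b, hb, rfl⟩; exact ⟨b, hb, a, ha, by simp⟩)
    (fun x z hz => gauge_ineq hK hK' hi hNt hN hM hintegral x hz)
  have : ρ = 2 * r := ball_radius_eq hρ.le (by positivity) (by rw [← hL, hvd])
  obtain ⟨c, hc⟩ := ball_of_diff hK hK' hr hv (this ▸ hL)
  exact ⟨c, r, hr, hc⟩

end Eqd

section Link

theorem reflection_eq_rfA {E : Type*} [NormedAddCommGroup E] [InnerProductSpace ℝ E]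
    [FiniteDimensional ℝ E] {u : E} (hu : ‖u‖ = 1) (h : ℝ)
    [Nonempty (AffineSubspace.mk' (h • u) (Submodule.span ℝ {u})ᗮ)] (x : E) :
    EuclideanGeometry.reflection (AffineSubspace.mk' (h • u) (Submodule.span ℝ {u})ᗮ) x = rfA u h x := by
  have huu : ⟪u, u⟫ = 1 := by rw [real_inner_self_eq_norm_sq, hu]; norm_num
  have hp : (EuclideanGeometry.orthogonalProjection (AffineSubspace.mk' (h • u) (Submodule.span ℝ {u})ᗮ) x : E)
      = x + (h - ⟪u, x⟫) • u := by
    rw [EuclideanGeometry.coe_orthogonalProjection_eq_iff_mem]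
    constructor
    · rw [AffineSubspace.mem_mk', Submodule.mem_orthogonal_singleton_iff_inner_right, vsub_eq_sub,
        inner_sub_right, inner_add_right, inner_smul_right, inner_smul_right, huu]
      ring
    · rw [AffineSubspace.direction_mk', Submodule.orthogonal_orthogonal, vsub_eq_sub]
      refine Submodule.mem_span_singleton.2 ⟨-(h - ⟪u, x⟫), ?_⟩
      module
  rw [EuclideanGeometry.reflection_apply', hp, rfA, vsub_eq_sub, vadd_eq_add]
  module

theorem mem_reflVols {d : ℕ} {K : Set (EuclideanSpace ℝ (Fin d))} {u : EuclideanSpace ℝ (Fin d)}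
    (hu : ‖u‖ = 1) {p : EuclideanSpace ℝ (Fin d)} (hp : p ∈ K) :
    (volume (convexHull ℝ (K ∪ rfA u ⟪u, p⟫ '' K))).toReal ∈ hyperplaneReflVols K := by
  have hne : Nonempty (AffineSubspace.mk' (⟪u, p⟫ • u) (Submodule.span ℝ {u})ᗮ) :=
    ⟨⟨_, AffineSubspace.self_mem_mk' _ _⟩⟩
  have he : (EuclideanGeometry.reflection (AffineSubspace.mk' (⟪u, p⟫ • u) (Submodule.span ℝ {u})ᗮ)) '' K =
      rfA u ⟪u, p⟫ '' K := image_congr fun x _ => reflection_eq_rfA hu _ x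
  refine ⟨_, hne, ?_, ?_, ?_⟩
  · rw [AffineSubspace.direction_mk', finrank_perp hu, finrank_euclideanSpace_fin]
  · rw [he]
    exact ⟨p, hp, p, hp, by simp [rfA]⟩
  · rw [he]

theorem hull_in_ball {d : ℕ} {K : Set (EuclideanSpace ℝ (Fin d))} {R : ℝ}
    (hR : K ⊆ Metric.closedBall 0 R) (H : AffineSubspace ℝ (EuclideanSpace ℝ (Fin d))) [Nonempty H]
    (hne : (K ∩ (EuclideanGeometry.reflection H) '' K).Nonempty) :
    convexHull ℝ (K ∪ (EuclideanGeometry.reflection H) '' K) ⊆ Metric.closedBall 0 (3 * R) := by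
  obtain ⟨_, hy, k, hk, rfl⟩ := hne
  have h1 := hR hy
  have h2 := hR hk
  rw [mem_closedBall_zero_iff] at h1 h2
  refine convexHull_min ?_ (convex_closedBall _ _)
  rintro x (hx | ⟨x, hx, rfl⟩)
  · have := hR hx
    rw [mem_closedBall_zero_iff] at this ⊢
    linarith [norm_nonneg k]
  · have h3 := hR hx
    rw [mem_closedBall_zero_iff] at h3 ⊢
    have h4 := (EuclideanGeometry.reflection H).dist_map x k
    rw [dist_eq_norm, dist_eq_norm] at h4
    have h5 := norm_sub_le x k
    have h6 := norm_add_le (EuclideanGeometry.reflection H x - EuclideanGeometry.reflection H k)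
      (EuclideanGeometry.reflection H k)
    rw [sub_add_cancel] at h6
    linarith

theorem reflVols_bdd {d : ℕ} {K : Set (EuclideanSpace ℝ (Fin d))} (hK : IsCompact K) :
    BddAbove (hyperplaneReflVols K) := by
  obtain ⟨R, hR⟩ := hK.isBounded.subset_closedBall 0
  refine ⟨(volume (Metric.closedBall (0 : EuclideanSpace ℝ (Fin d)) (3 * R))).toReal, ?_⟩
  rintro _ ⟨H, hH, -, hne, rfl⟩
  exact ENNReal.toReal_mono measure_closedBall_lt_top.ne (measure_mono (hull_in_ball hR H hne))

theorem hull_le_sSup {d : ℕ} {K : Set (EuclideanSpace ℝ (Fin d))} (hK : IsCompact K) (hK' : Convex ℝ K)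
    {u : EuclideanSpace ℝ (Fin d)}
    (hu : ‖u‖ = 1) {p : EuclideanSpace ℝ (Fin d)} (hp : p ∈ K) :
    volume (convexHull ℝ (K ∪ rfA u ⟪u, p⟫ '' K)) ≤ ENNReal.ofReal (sSup (hyperplaneReflVols K)) := by
  have h := le_csSup (reflVols_bdd hK) (mem_reflVols hu hp)
  have hc := hull_compact hK hK' (hK.image (rfA_continuous u ⟪u, p⟫)) (rfA_convex u _ hK')
  rw [← ENNReal.ofReal_toReal hc.measure_lt_top.ne]
  exact ENNReal.ofReal_le_ofReal h

theorem reflVols_hN {d : ℕ} {K : Set (EuclideanSpace ℝ (Fin d))} (hK : IsCompact K) (hK' : Convex ℝ K)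
    (hne : K.Nonempty) (u : EuclideanSpace ℝ (Fin d)) (hu : ‖u‖ = 1) (z : EuclideanSpace ℝ (Fin d))
    (hz : z ∈ K - K) : volume K + ENNReal.ofReal ⟪u, z⟫ * volume (prj u K) ≤
      ENNReal.ofReal (sSup (hyperplaneReflVols K)) := by
  have hc : ContinuousOn (fun x : EuclideanSpace ℝ (Fin d) => ⟪u, x⟫) K := by fun_prop
  obtain ⟨p, hp, hmax⟩ := hK.exists_isMaxOn hne hc
  obtain ⟨q, hq, hmin⟩ := hK.exists_isMinOn hne hc
  have h := two_hulls hu hK hK' (a := ⟪u, q⟫) (b := ⟪u, p⟫) (fun k hk => ⟨hmin hk, hmax hk⟩) (hmin hp)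
  have h2 := h.trans (add_le_add (hull_le_sSup hK hK' hu hp) (hull_le_sSup hK hK' hu hq))
  rw [← two_mul, ENNReal.mul_le_mul_iff_right (by norm_num) (by norm_num)] at h2
  refine le_trans ?_ h2
  obtain ⟨a, ha, b, hb, rfl⟩ := hz
  have i1 : ⟪u, a⟫ ≤ ⟪u, p⟫ := hmax ha
  have i2 : ⟪u, q⟫ ≤ ⟪u, b⟫ := hmin hb
  gcongr
  simp only [inner_sub_right]
  linarith

theorem ball_reflVols_le {d : ℕ} (hd : 2 ≤ d) {c : EuclideanSpace ℝ (Fin d)} {r : ℝ} (hr : 0 < r) {v : ℝ}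
    (hv : v ∈ hyperplaneReflVols (Metric.closedBall c r)) :
    v ≤ (1 + 2 * unitBallVol (d - 1) / unitBallVol d) * (volume (Metric.closedBall c r)).toReal := by
  obtain ⟨H, hH, -, hne, rfl⟩ := hv
  have him : (EuclideanGeometry.reflection H) '' (Metric.closedBall c r) =
      Metric.closedBall (EuclideanGeometry.reflection H c) r :=
    (EuclideanGeometry.reflection H).toIsometryEquiv.image_closedBall c r
  rw [him] at hne ⊢
  set y := EuclideanGeometry.reflection H c
  have hdist : ‖y - c‖ ≤ 2 * r := by
    obtain ⟨w, h1, h2⟩ := hne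
    rw [Metric.mem_closedBall] at h1 h2
    have := dist_triangle y w c
    rw [dist_comm y w] at this
    rw [← dist_eq_norm]
    linarith
  have hsub : convexHull ℝ (Metric.closedBall c r ∪ Metric.closedBall y r) ⊆
      sweep (Metric.closedBall c r) (y - c) := by
    refine convexHull_min ?_ (sweep_convex (convex_closedBall _ _) _)
    rintro x (hx | hx)
    · exact mem_sweep.2 ⟨x, hx, 0, by simp, by simp⟩
    · refine mem_sweep.2 ⟨x - (y - c), ?_, 1, by simp, by simp⟩
      rw [mem_closedBall_iff_norm] at hx ⊢
      convert hx using 2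
      abel
  have h1 := measure_mono (μ := volume) hsub
  rw [volume_sweep_ball c _ hr.le, finrank_euclideanSpace_fin, volume_ball_eq finrank_euclideanSpace_fin c hr.le] at h1
  have hω : volume (Metric.closedBall (0 : EuclideanSpace ℝ (Fin (d - 1))) 1) = ENNReal.ofReal (unitBallVol (d - 1)) :=
    (ENNReal.ofReal_toReal measure_closedBall_lt_top.ne).symm
  have hν : volume (Metric.closedBall (0 : EuclideanSpace ℝ (Fin d)) 1) = ENNReal.ofReal (unitBallVol d) :=
    (ENNReal.ofReal_toReal measure_closedBall_lt_top.ne).symm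
  have hω0 : 0 ≤ unitBallVol (d - 1) := ENNReal.toReal_nonneg
  have hν0 : 0 < unitBallVol d :=
    ENNReal.toReal_pos (Metric.measure_closedBall_pos _ _ one_pos).ne' measure_closedBall_lt_top.ne
  rw [volume_ball_eq finrank_euclideanSpace_fin c hr.le, hν, ← ENNReal.ofReal_mul (by positivity),
    ENNReal.toReal_ofReal (by positivity)]
  rw [hω, hν, ← ENNReal.ofReal_mul (by positivity), ← ENNReal.ofReal_mul (by positivity),
    ← ENNReal.ofReal_mul (by positivity), ← ENNReal.ofReal_add (by positivity) (by positivity)] at h1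
  refine (ENNReal.toReal_le_of_le_ofReal (by positivity) h1).trans ?_
  have hpow : r ^ d = r ^ (d-1) * r := by rw [← pow_succ]; congr 1; omega
  have e : (1 + 2 * unitBallVol (d - 1) / unitBallVol d) * (r ^ d * unitBallVol d) =
      r ^ d * unitBallVol d + (2 * r) * (r ^ (d - 1) * unitBallVol (d - 1)) := by
    rw [hpow]; field_simp
  rw [e]
  gcongr

end Link

end Auxiliary

/-- G.Horváth–Lángi: for a convex body `K` in Euclidean `d`-space, the supremum over affine
hyperplanes `H` with `K ∩ σ_H(K) ≠ ∅` of `vol(convexHull ℝ (K ∪ σ_H(K)))` is at least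
`(1 + 2·v_{d−1}/v_d)·vol(K)`, with equality if and only if `K` is a closed Euclidean ball. -/
theorem hyperplane_reflection_hull_volume_ge (d : ℕ) (hd : 2 ≤ d)
    (K : Set (EuclideanSpace ℝ (Fin d)))
    (hKc : IsCompact K) (hKconv : Convex ℝ K) (hKint : (interior K).Nonempty) :
    sSup (hyperplaneReflVols K) ≥
      (1 + 2 * unitBallVol (d - 1) / unitBallVol d) * (volume K).toReal ∧
    (sSup (hyperplaneReflVols K) =
        (1 + 2 * unitBallVol (d - 1) / unitBallVol d) * (volume K).toReal ↔
      ∃ (c : EuclideanSpace ℝ (Fin d)) (r : ℝ), 0 < r ∧ K = Metric.closedBall c r) := by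
  have hnt : Nontrivial (EuclideanSpace ℝ (Fin d)) :=
    Module.nontrivial_of_finrank_pos (R := ℝ) (by rw [finrank_euclideanSpace_fin]; omega)
  have hne : K.Nonempty := Set.Nonempty.mono interior_subset hKint
  have hN := reflVols_hN hKc hKconv hne
  set S := sSup (hyperplaneReflVols K) with hS
  obtain ⟨w, hw⟩ := exists_norm_eq (EuclideanSpace ℝ (Fin d)) (zero_le_one (α := ℝ))
  obtain ⟨k, hk⟩ := hne
  have hVN : volume K ≤ ENNReal.ofReal S := by
    have := hN w hw (k - k) (Set.sub_mem_sub hk hk)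
    exact le_trans le_self_add this
  have hS0 : 0 ≤ S := (ENNReal.toReal_nonneg).trans (le_csSup (reflVols_bdd hKc) (mem_reflVols hw hk))
  have hω : ∀ n, n = d - 1 → unitBallVol (d - 1) =
      (volume (Metric.closedBall (0 : EuclideanSpace ℝ (Fin n)) 1)).toReal := by rintro _ rfl; rfl
  have hν : ∀ n, n = d → unitBallVol d =
      (volume (Metric.closedBall (0 : EuclideanSpace ℝ (Fin n)) 1)).toReal := by rintro _ rfl; rfl
  have hω' := hω (Module.finrank ℝ (EuclideanSpace ℝ (Fin d)) - 1) (by rw [finrank_euclideanSpace_fin])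
  have hν' := hν (Module.finrank ℝ (EuclideanSpace ℝ (Fin d))) (by rw [finrank_euclideanSpace_fin])
  have hm : S - (volume K).toReal = (ENNReal.ofReal S - volume K).toReal := by
    rw [ENNReal.toReal_sub_of_le hVN ENNReal.ofReal_ne_top, ENNReal.toReal_ofReal hS0]
  have h1 := (main_ineq hKc hKconv hKint ENNReal.ofReal_ne_top hN hω' hν' hm).1
  have hge : (1 + 2 * unitBallVol (d - 1) / unitBallVol d) * (volume K).toReal ≤ S := by
    rw [add_mul, one_mul]; linarith
  refine ⟨hge, fun heq => ?_, ?_⟩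
  · refine main_eq hKc hKconv hKint ENNReal.ofReal_ne_top hN hω' hν' hm ?_
    rw [heq, add_mul, one_mul]; linarith
  · rintro ⟨c, r, hr, hball⟩
    refine le_antisymm ?_ hge
    refine csSup_le ⟨_, mem_reflVols hw hk⟩ fun v hv => ?_
    rw [hball] at hv ⊢
    exact ball_reflVols_le hd hr hv
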